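/- arXiv:0805.2033 — 4 statements merged into one kernel-verified Lean document; each statement's English description precedes it below -/
import Mathlib

section
/- Let X be a countable infinite set and 𝒜 ⊆ 𝒫∞(X) an M-family which is C-measurable. Then for every sequence (A_n) in 𝒜^{⊥⊥} there exists A ∈ 𝒜^{⊥⊥} such that A ∩ A_n is infinite for infinitely many n ∈ ℕ. -/
open Set

/-- The characteristic function of a set, viewing `2^X` as `X → Bool`. -/
noncomputable def chi {X : Type*} (A : Set X) : X → Bool :=
  fun x => @decide (x ∈ A) (Classical.dec _)

/-- `𝒫∞(X)`: the family of all infinite subsets of `X`. -/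
def PInf (X : Type*) : Set (Set X) := {A | A.Infinite}

/-- A family of infinite sets is hereditary if every infinite subset of a member is a member. -/
def Hered {X : Type*} (F : Set (Set X)) : Prop :=
  ∀ A ∈ F, ∀ B ⊆ A, B.Infinite → B ∈ F

/-- Two families are orthogonal if `A ∩ B` is finite for all `A ∈ F`, `B ∈ G`. -/
def OrthFam {X : Type*} (F G : Set (Set X)) : Prop :=
  ∀ A ∈ F, ∀ B ∈ G, (A ∩ B).Finite

/-- The orthogonal `F^⊥` of a family `F`. -/
def perp {X : Type*} (F : Set (Set X)) : Set (Set X) :=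
  {B | B.Infinite ∧ ∀ A ∈ F, (B ∩ A).Finite}

/-- A hereditary family `F` is an M-family if for every sequence `(A n)` in `F` there is
`B ∈ F` all but finitely many of whose elements lie in `⋃_{i ≥ n} A i`, for every `n`. -/
def MFamily {X : Type*} (F : Set (Set X)) : Prop :=
  Hered F ∧ ∀ A : ℕ → Set X, (∀ n, A n ∈ F) →
    ∃ B ∈ F, ∀ n : ℕ, (B \ ⋃ i : ℕ, ⋃ _ : n ≤ i, A i).Finite

/-- `F` is countably generated in `G`. -/
def CountGen {X : Type*} (F G : Set (Set X)) : Prop :=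
  ∃ B : ℕ → Set X, (∀ n, B n ∈ G) ∧ ∀ A ∈ F, ∃ n, (A \ B n).Finite

/-- The C-measurable sets: the smallest σ-algebra containing the open sets and closed
under the Souslin operation. -/
inductive CMeas {α : Type*} [TopologicalSpace α] : Set α → Prop
  | isOpen (s : Set α) : IsOpen s → CMeas s
  | compl (s : Set α) : CMeas s → CMeas sᶜ
  | iUnion (f : ℕ → Set α) : (∀ n, CMeas (f n)) → CMeas (⋃ n, f n)
  | souslin (P : List ℕ → Set α) : (∀ s, CMeas (P s)) →
      CMeas (⋃ σ : ℕ → ℕ, ⋂ n : ℕ, P (List.ofFn fun i : Fin n => σ i))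

/-- A family of subsets of `X` is analytic if its image in `2^X = X → Bool` under
characteristic functions is an analytic set. -/
def AnalyticFam {X : Type*} (F : Set (Set X)) : Prop :=
  MeasureTheory.AnalyticSet (chi '' F : Set (X → Bool))

/-- A family of subsets of `X` is C-measurable if its image in `2^X = X → Bool` is. -/
def CMeasFam {X : Type*} (F : Set (Set X)) : Prop :=
  CMeas (chi '' F : Set (X → Bool))

/-- A perfect Lusin gap inside the pair `(F, G)`. -/
def PerfectLusinGap (F G : Set (Set ℕ)) : Prop :=
  ∃ A B : (ℕ → Bool) → Set ℕ,
    Continuous (fun x => (chi (A x), chi (B x))) ∧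
    Function.Injective (fun x => (A x, B x)) ∧
    (∀ x, A x ∈ F) ∧ (∀ x, B x ∈ G) ∧
    (∀ x, A x ∩ B x = ∅) ∧
    (∀ x y, x ≠ y → ((A x ∩ B y) ∪ (A y ∩ B x)).Nonempty)


namespace Ell

/-- basic Ellentuck-type neighbourhood -/
def cube (b : Set ℕ) (n : ℕ) (C : Set ℕ) : Set (Set ℕ) :=
  {E | E.Infinite ∧ (∀ x, x < n → (x ∈ E ↔ x ∈ b)) ∧ (∀ x, n ≤ x → x ∈ E → x ∈ C)}

def CR (S : Set (Set ℕ)) : Prop :=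
  ∀ b n (A : Set ℕ), A.Infinite → ∃ B ⊆ A, B.Infinite ∧
    (cube b n B ⊆ S ∨ ∀ E ∈ cube b n B, E ∉ S)

lemma inf_ge {E : Set ℕ} (h : E.Infinite) (n : ℕ) : ∃ x ∈ E, n ≤ x := by
  obtain ⟨x, hx, hn⟩ := h.exists_gt n
  exact ⟨x, hx, hn.le⟩

lemma inf_inter_Ici {E : Set ℕ} (h : E.Infinite) (n : ℕ) : (E ∩ Ici n).Infinite := by
  have : E ∩ Ici n = E \ Iio n := by ext x; simp
  rw [this]
  exact h.diff (finite_Iio n)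

lemma cube_congr {b b' : Set ℕ} {n : ℕ} (C : Set ℕ) (h : ∀ x, x < n → (x ∈ b ↔ x ∈ b')) :
    cube b n C = cube b' n C := by
  ext E
  constructor
  · rintro ⟨h1, h2, h3⟩
    exact ⟨h1, fun x hx => (h2 x hx).trans (h x hx), h3⟩
  · rintro ⟨h1, h2, h3⟩
    exact ⟨h1, fun x hx => (h2 x hx).trans (h x hx).symm, h3⟩

lemma cube_inter (b : Set ℕ) (n : ℕ) (C : Set ℕ) : cube (b ∩ Iio n) n C = cube b n C :=
  cube_congr C (fun x hx => by simp [hx])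

lemma cube_mono {b : Set ℕ} {n : ℕ} {C C' : Set ℕ} (h : ∀ x ∈ C', n ≤ x → x ∈ C) :
    cube b n C' ⊆ cube b n C := fun _ ⟨h1, h2, h3⟩ => ⟨h1, h2, fun x hx hE => h x (h3 x hx hE) hx⟩

lemma cube_nonempty (b : Set ℕ) (n : ℕ) {C : Set ℕ} (h : C.Infinite) : (cube b n C).Nonempty := by
  refine ⟨(b ∩ Iio n) ∪ (C ∩ Ici n), (inf_inter_Ici h n).mono subset_union_right, ?_, ?_⟩
  · intro x hx
    simp [hx]
  · intro x hx
    simp [hx, hx.not_gt]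

lemma self_mem {E : Set ℕ} {a : Set ℕ} {m n : ℕ} {B : Set ℕ} (hE : E ∈ cube a m B) (h : m ≤ n) :
    E ∈ cube E n B := ⟨hE.1, fun _ _ => Iff.rfl, fun x hx hxE => hE.2.2 x (h.trans hx) hxE⟩

lemma cube_sub {E F : Set ℕ} {a : Set ℕ} {m n : ℕ} {B D : Set ℕ} (hE : E ∈ cube a m B)
    (hD : D ⊆ B) (h : m ≤ n) (hF : F ∈ cube E n D) : F ∈ cube a m B := by
  refine ⟨hF.1, fun x hx => (hF.2.1 x (hx.trans_le h)).trans (hE.2.1 x hx), fun x hx hxF => ?_⟩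
  by_cases hn : n ≤ x
  · exact hD (hF.2.2 x hn hxF)
  · exact hE.2.2 x hx ((hF.2.1 x (not_le.1 hn)).1 hxF)

lemma finite_dense {ι : Type*} {I : Set ι} (hI : I.Finite) (R : ι → Set ℕ → Prop)
    (hmono : ∀ i C C', C' ⊆ C → R i C → R i C')
    (hd : ∀ i (C : Set ℕ), C.Infinite → ∃ D ⊆ C, D.Infinite ∧ R i D) :
    ∀ C : Set ℕ, C.Infinite → ∃ D ⊆ C, D.Infinite ∧ ∀ i ∈ I, R i D := by
  induction I, hI using Set.Finite.induction_on with
  | empty => exact fun C hC => ⟨C, Subset.rfl, hC, by simp⟩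
  | insert _ _ ih =>
    intro C hC
    obtain ⟨D, hDC, hD, h⟩ := ih C hC
    obtain ⟨D', hDD, hD', h'⟩ := hd _ D hD
    refine ⟨D', hDD.trans hDC, hD', ?_⟩
    rintro i (rfl | hi)
    · exact h'
    · exact hmono _ _ _ hDD (h i hi)

lemma fusion (Q : Set ℕ → ℕ → Set ℕ → Prop)
    (hext : ∀ b n C, Q (b ∩ Iio n) n C → Q b n C)
    (hmono : ∀ b n C C', (∀ x ∈ C', n ≤ x → x ∈ C) → Q b n C → Q b n C')
    (hd : ∀ b n (C : Set ℕ), C.Infinite → ∃ D ⊆ C, D.Infinite ∧ Q b n D)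
    (a : Set ℕ) (m : ℕ) (A : Set ℕ) (hA : A.Infinite) :
    ∃ B ⊆ A, B.Infinite ∧ Q a m B ∧ ∀ x ∈ B, ∀ b, Q b (x+1) B := by
  obtain ⟨A', hA'A, hA', hQ⟩ := hd a m A hA
  have step : ∀ n (C : Set ℕ), C.Infinite → ∃ D ⊆ C, D.Infinite ∧ (∀ x ∈ D, n ≤ x) ∧
      ∀ b, Q b n D := by
    intro n C hC
    obtain ⟨D, hDC, hD, h⟩ := finite_dense (finite_Iio n).finite_subsets (fun b C => Q b n C)
      (fun b C C' h => hmono b n C C' (fun x hx _ => h hx)) (fun b => hd b n) _ (inf_inter_Ici hC n)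
    exact ⟨D, fun x hx => (hDC hx).1, hD, fun x hx => (hDC hx).2, fun b =>
      hext _ _ _ (h _ inter_subset_right)⟩
  choose! f hf1 hf2 hf3 hf4 using step
  let S : ℕ → Set ℕ := fun k => Nat.rec A' (fun _ C => f (sInf C + 1) C) k
  have S0 : S 0 = A' := rfl
  have Ss : ∀ k, S (k+1) = f (sInf (S k) + 1) (S k) := fun k => rfl
  have hS : ∀ k, (S k).Infinite := by
    intro k
    induction k with
    | zero => exact hA'
    | succ k ih => rw [Ss]; exact hf2 _ _ ih
  have hanti : Antitone S := antitone_nat_of_succ_le fun k => by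
    rw [Ss]; exact hf1 _ _ (hS k)
  let x : ℕ → ℕ := fun k => sInf (S k)
  have hx : ∀ k, x k ∈ S k := fun k => Nat.sInf_mem (hS k).nonempty
  have hlt : ∀ k, x k < x (k+1) := fun k => by
    have := hx (k+1)
    rw [Ss] at this
    exact hf3 _ _ (hS k) _ this
  have hsm : StrictMono x := strictMono_nat_of_lt_succ hlt
  refine ⟨range x, ?_, infinite_range_of_injective hsm.injective, ?_, ?_⟩
  · rintro _ ⟨k, rfl⟩
    exact hA'A (hanti (Nat.zero_le k) (hx k))
  · refine hmono _ _ _ _ ?_ hQ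
    rintro _ ⟨k, rfl⟩ _
    exact hanti (Nat.zero_le k) (hx k)
  · rintro _ ⟨k, rfl⟩ b
    refine hmono _ _ _ _ ?_ (hf4 _ _ (hS k) b)
    rintro _ ⟨j, rfl⟩ hj
    have : k + 1 ≤ j := hsm.lt_iff_lt.1 hj
    rw [← Ss]
    exact hanti this (hx j)

/-- countable version -/
lemma fusion_count (Q : ℕ → Set ℕ → ℕ → Set ℕ → Prop)
    (hext : ∀ k b n C, Q k (b ∩ Iio n) n C → Q k b n C)
    (hmono : ∀ k b n C C', (∀ x ∈ C', n ≤ x → x ∈ C) → Q k b n C → Q k b n C')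
    (hd : ∀ k b n (C : Set ℕ), C.Infinite → ∃ D ⊆ C, D.Infinite ∧ Q k b n D)
    (A : Set ℕ) (hA : A.Infinite) :
    ∃ B ⊆ A, B.Infinite ∧ ∀ k, ∀ x ∈ B, k ≤ x → ∀ b, Q k b (x+1) B := by
  obtain ⟨B, h1, h2, -, h3⟩ := fusion (fun b n C => ∀ k ∈ Iio n, Q k b n C)
    (fun b n C h k hk => hext _ _ _ _ (h k hk))
    (fun b n C C' h h' k hk => hmono _ _ _ _ _ h (h' k hk))
    (fun b n C hC => finite_dense (finite_Iio n) (fun k C => Q k b n C)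
      (fun k C C' h => hmono k b n C C' (fun x hx _ => h hx)) (fun k => hd k b n) C hC)
    ∅ 0 A hA
  exact ⟨B, h1, h2, fun k x hx hk b => h3 x hx b k (Nat.lt_succ_of_le hk)⟩

lemma CR.compl {S : Set (Set ℕ)} (h : CR S) : CR Sᶜ := by
  intro b n A hA
  obtain ⟨B, h1, h2, h3⟩ := h b n A hA
  refine ⟨B, h1, h2, ?_⟩
  rcases h3 with h3 | h3
  · exact Or.inr fun E hE h => h (h3 hE)
  · exact Or.inl fun E hE => h3 E hE

lemma CR.inter {S T : Set (Set ℕ)} (hS : CR S) (hT : CR T) : CR (S ∩ T) := by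
  intro b n A hA
  obtain ⟨B, h1, h2, h3⟩ := hS b n A hA
  obtain ⟨C, h4, h5, h6⟩ := hT b n B h2
  have hsub : cube b n C ⊆ cube b n B := cube_mono fun x hx _ => h4 hx
  refine ⟨C, h4.trans h1, h5, ?_⟩
  rcases h3 with h3 | h3
  · rcases h6 with h6 | h6
    · exact Or.inl fun E hE => ⟨h3 (hsub hE), h6 hE⟩
    · exact Or.inr fun E hE h => h6 E hE h.2
  · exact Or.inr fun E hE h => h3 E (hsub hE) h.1

lemma CR.of_agree {S : Set (Set ℕ)}
    (h : ∀ b n (A : Set ℕ), A.Infinite → ∃ B ⊆ A, B.Infinite ∧ ∃ T, CR T ∧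
      ∀ E ∈ cube b n B, (E ∈ S ↔ E ∈ T)) : CR S := by
  intro b n A hA
  obtain ⟨B, h1, h2, T, hT, h3⟩ := h b n A hA
  obtain ⟨C, h4, h5, h6⟩ := hT b n B h2
  have hsub : cube b n C ⊆ cube b n B := cube_mono fun x hx _ => h4 hx
  refine ⟨C, h4.trans h1, h5, ?_⟩
  rcases h6 with h6 | h6
  · exact Or.inl fun E hE => (h3 E (hsub hE)).2 (h6 hE)
  · exact Or.inr fun E hE h => h6 E hE ((h3 E (hsub hE)).1 h)

def Op (O : Set (Set ℕ)) : Prop :=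
  ∀ E ∈ O, E.Infinite → ∃ n, ∀ E' : Set ℕ, E'.Infinite → (∀ x, x < n → (x ∈ E' ↔ x ∈ E)) → E' ∈ O

lemma CR_open {O : Set (Set ℕ)} (hO : Op O) : CR O := by
  intro a m A hA
  obtain ⟨B, hBA, hB, hdec0, hdec⟩ := fusion
    (fun b n C => cube b n C ⊆ O ∨ ∀ D ⊆ C, D.Infinite → ¬ cube b n D ⊆ O)
    (fun b n C h => by simpa only [cube_inter] using h)
    (by
      rintro b n C C' h (h1 | h1)
      · exact Or.inl ((cube_mono h).trans h1)
      · refine Or.inr fun D hD hDi h2 => ?_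
        exact h1 (D ∩ Ici n) (fun x hx => h x (hD hx.1) hx.2) (inf_inter_Ici hDi n)
          ((cube_mono fun x hx _ => hx.1).trans h2))
    (by
      intro b n C hC
      by_cases h : ∃ D ⊆ C, D.Infinite ∧ cube b n D ⊆ O
      · obtain ⟨D, h1, h2, h3⟩ := h
        exact ⟨D, h1, h2, Or.inl h3⟩
      · push Not at h
        exact ⟨C, Subset.rfl, hC, Or.inr h⟩)
    a m A hA
  rcases hdec0 with h0 | h0
  · exact ⟨B, hBA, hB, Or.inl h0⟩
  let rej : Set ℕ → ℕ → Prop := fun b n => ∀ D ⊆ B, D.Infinite → ¬ cube b n D ⊆ O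
  have rej_congr : ∀ {b b' : Set ℕ} {n}, (∀ x, x < n → (x ∈ b ↔ x ∈ b')) → rej b n → rej b' n := by
    intro b b' n h hr D hD hDi
    rw [← cube_congr D h]
    exact hr D hD hDi
  have key : ∀ b n, rej b n → {x | x ∈ B ∧ n ≤ x ∧ ¬ rej (insert x (b ∩ Iio n)) (x+1)}.Finite := by
    intro b n hr
    by_contra hinf
    refine hr _ (fun x hx => hx.1) hinf ?_
    intro E hE
    have hne : ∃ x, x ∈ E ∧ n ≤ x := by
      obtain ⟨x, h1, h2⟩ := inf_ge hE.1 n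
      exact ⟨x, h1, h2⟩
    classical
    obtain ⟨h1, h2⟩ := Nat.find_spec hne
    have hmin : ∀ y, y ∈ E → n ≤ y → Nat.find hne ≤ y := fun y h3 h4 => Nat.find_min' hne ⟨h3, h4⟩
    generalize Nat.find hne = x at h1 h2 hmin
    obtain ⟨h3, h4, h5⟩ := hE.2.2 x h2 h1
    rcases hdec x h3 (insert x (b ∩ Iio n)) with h6 | h6
    · apply h6
      refine ⟨hE.1, ?_, ?_⟩
      · intro y hy
        by_cases hyn : y < n
        · rw [hE.2.1 y hyn]
          simp [hyn]
          intro h; omega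
        · simp [hyn]
          constructor
          · intro hyE
            have := hmin y hyE (not_lt.1 hyn)
            omega
          · rintro rfl; exact h1
      · intro y hy hyE
        exact (hE.2.2 y (by omega) hyE).1
    · exact absurd h6 h5
  obtain ⟨C, hCB, hC, hQ0, hQ⟩ := fusion
    (fun b n C => rej b n → ∀ x ∈ C, x ∈ B → n ≤ x → rej (insert x (b ∩ Iio n)) (x+1))
    (by
      intro b n C h hr x hx hxB hn
      have := h (rej_congr (fun y hy => by simp [hy]) hr) x hx hxB hn
      simpa [inter_assoc] using this)
    (by
      intro b n C C' h h1 hr x hx hxB hn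
      exact h1 hr x (h x hx hn) hxB hn)
    (by
      intro b n C hC
      by_cases hr : rej b n
      · refine ⟨C \ {x | x ∈ B ∧ n ≤ x ∧ ¬ rej (insert x (b ∩ Iio n)) (x+1)}, diff_subset,
          hC.diff (key b n hr), ?_⟩
        intro _ x hx hxB hn
        by_contra hcon
        exact hx.2 ⟨hxB, hn, hcon⟩
      · exact ⟨C, Subset.rfl, hC, fun h => absurd h hr⟩)
    a m B hB
  refine ⟨C, hCB.trans hBA, hC, Or.inr ?_⟩
  intro E hE hEO
  have all : ∀ x, x ∈ E → m ≤ x → rej E (x+1) := by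
    intro x
    induction x using Nat.strong_induction_on with
    | _ x ih =>
      intro hxE hmx
      have hxC := hE.2.2 x hmx hxE
      by_cases hp : ∃ y, y ∈ E ∧ m ≤ y ∧ y < x
      · classical
        have : ∃ y, (y ∈ E ∧ m ≤ y ∧ y < x) ∧ ∀ z, z ∈ E → m ≤ z → z < x → z ≤ y := by
          have hf : ({y | y ∈ E ∧ m ≤ y ∧ y < x}).Finite :=
            (finite_Iio x).subset fun y hy => hy.2.2
          obtain ⟨y, hy⟩ := hf.exists_maximal hp
          refine ⟨y, hy.1, fun z h1 h2 h3 => ?_⟩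
          by_contra hlt
          exact hlt (hy.2 ⟨h1, h2, h3⟩ (not_le.1 hlt).le)
        obtain ⟨y, ⟨hyE, hmy, hyx⟩, hmax⟩ := this
        have hyC := hE.2.2 y hmy hyE
        refine rej_congr ?_ (hQ y hyC E (ih y hyx hyE hmy) x hxC (hCB hxC) hyx)
        intro z hz
        simp only [mem_insert_iff, mem_inter_iff, mem_Iio]
        constructor
        · rintro (rfl | h)
          · exact hxE
          · exact h.1
        · intro hzE
          by_cases hzx : z = x
          · exact Or.inl hzx
          · refine Or.inr ⟨hzE, ?_⟩
            by_cases hmz : m ≤ z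
            · have := hmax z hzE hmz (by omega)
              omega
            · omega
      · push Not at hp
        refine rej_congr ?_ (hQ0 h0 x hxC (hCB hxC) hmx)
        intro z hz
        simp only [mem_insert_iff, mem_inter_iff, mem_Iio]
        constructor
        · rintro (rfl | h)
          · exact hxE
          · exact (hE.2.1 z h.2).2 h.1
        · intro hzE
          by_cases hzx : z = x
          · exact Or.inl hzx
          · have : z < m := by
              by_contra hmz
              have := hp z hzE (not_lt.1 hmz)
              omega
            exact Or.inr ⟨(hE.2.1 z this).1 hzE, this⟩
  obtain ⟨n, hn⟩ := hO E hEO hE.1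
  obtain ⟨x, hxE, hx⟩ := inf_ge hE.1 (max n m)
  have h1 : n ≤ x := (le_max_left _ _).trans hx
  have h2 : m ≤ x := (le_max_right _ _).trans hx
  refine all x hxE h2 B Subset.rfl hB ?_
  intro F hF
  exact hn F hF.1 fun y hy => hF.2.1 y (by omega)

lemma decide_all (S : ℕ → Set (Set ℕ)) (hS : ∀ k, CR (S k)) (A : Set ℕ) (hA : A.Infinite) :
    ∃ B ⊆ A, B.Infinite ∧ ∀ k, ∀ x ∈ B, k ≤ x → ∀ b,
      (cube b (x+1) B ⊆ S k ∨ ∀ E ∈ cube b (x+1) B, E ∉ S k) :=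
  fusion_count (fun k b n C => cube b n C ⊆ S k ∨ ∀ E ∈ cube b n C, E ∉ S k)
    (fun k b n C h => by simpa only [cube_inter] using h)
    (by
      rintro k b n C C' h (h1 | h1)
      · exact Or.inl ((cube_mono h).trans h1)
      · exact Or.inr fun E hE => h1 E (cube_mono h hE))
    (fun k b n C hC => hS k b n C hC) A hA

lemma CR.iUnion (S : ℕ → Set (Set ℕ)) (hS : ∀ k, CR (S k)) : CR (⋃ k, S k) := by
  apply CR.of_agree
  intro a m A hA
  obtain ⟨B, hBA, hB, hdec⟩ := decide_all S hS A hA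
  refine ⟨B, hBA, hB, {E | ∃ k, ∃ x ∈ E, k ≤ x ∧ m ≤ x ∧ cube E (x+1) B ⊆ S k}, ?_, ?_⟩
  · apply CR_open
    rintro E ⟨k, x, hxE, hk, hm, h⟩ _
    refine ⟨x+1, fun E' _ hE' => ⟨k, x, (hE' x (by omega)).2 hxE, hk, hm, ?_⟩⟩
    rw [cube_congr B hE']
    exact h
  · intro E hE
    constructor
    · intro h
      obtain ⟨k, hk⟩ := mem_iUnion.1 h
      obtain ⟨x, hxE, hx⟩ := inf_ge hE.1 (max k m)
      have h1 : k ≤ x := (le_max_left _ _).trans hx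
      have h2 : m ≤ x := (le_max_right _ _).trans hx
      refine ⟨k, x, hxE, h1, h2, ?_⟩
      rcases hdec k x (hE.2.2 x h2 hxE) h1 E with h3 | h3
      · exact h3
      · exact absurd hk (h3 E (self_mem hE (by omega)))
    · rintro ⟨k, x, hxE, hk, hm, h⟩
      exact mem_iUnion.2 ⟨k, h (self_mem hE (by omega))⟩

lemma CR.souslin (P : List ℕ → Set (Set ℕ)) (hP : ∀ s, CR (P s)) :
    CR (⋃ σ : ℕ → ℕ, ⋂ n : ℕ, P (List.ofFn fun i : Fin n => σ i)) := by
  apply CR.of_agree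
  intro a m A hA
  let Y : List ℕ → Set (Set ℕ) := fun s => {E | ∃ σ : ℕ → ℕ,
    (List.ofFn fun i : Fin s.length => σ i) = s ∧ ∀ n, E ∈ P (List.ofFn fun i : Fin n => σ i)}
  have hYP : ∀ s, Y s ⊆ P s := by
    rintro s E ⟨σ, h1, h2⟩
    rw [← h1]; exact h2 _
  have hYs : ∀ s, ∀ E ∈ Y s, ∃ n, E ∈ Y (s ++ [n]) := by
    rintro s E ⟨σ, h1, h2⟩
    refine ⟨σ s.length, σ, ?_, h2⟩
    have : (s ++ [σ s.length]).length = s.length + 1 := by simp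
    rw [this, List.ofFn_succ']
    simp only [Fin.val_castSucc, Fin.val_last, List.concat_eq_append]
    rw [h1]
  let Z : ℕ → Set (Set ℕ) := fun k => {E | ∃ s, Encodable.encode s = k ∧ E ∈ Y s}
  have hZ : ∀ s E, E ∈ Z (Encodable.encode s) ↔ E ∈ Y s := by
    intro s E
    constructor
    · rintro ⟨t, h1, h2⟩
      rwa [← Encodable.encode_injective h1]
    · exact fun h => ⟨s, rfl, h⟩
  obtain ⟨B, hBA, hB, hdec⟩ := fusion_count
    (fun k b n C => (∀ E ∈ cube b n C, E ∉ Z k) ∨ ∀ D ⊆ C, D.Infinite → ∃ E ∈ cube b n D, E ∈ Z k)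
    (fun k b n C h => by simpa only [cube_inter] using h)
    (by
      rintro k b n C C' h (h1 | h1)
      · exact Or.inl fun E hE => h1 E (cube_mono h hE)
      · refine Or.inr fun D hD hDi => ?_
        obtain ⟨E, hE, hEZ⟩ := h1 (D ∩ Ici n) (fun x hx => h x (hD hx.1) hx.2) (inf_inter_Ici hDi n)
        exact ⟨E, cube_mono (fun x hx _ => hx.1) hE, hEZ⟩)
    (by
      intro k b n C hC
      by_cases h : ∃ D ⊆ C, D.Infinite ∧ ∀ E ∈ cube b n D, E ∉ Z k
      · obtain ⟨D, h1, h2, h3⟩ := h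
        exact ⟨D, h1, h2, Or.inl h3⟩
      · push Not at h
        exact ⟨C, Subset.rfl, hC, Or.inr h⟩)
    A hA
  let Φ : List ℕ → Set (Set ℕ) := fun s => {E | ∀ x ∈ E, Encodable.encode s ≤ x → m ≤ x →
    ∃ F ∈ cube E (x+1) B, F ∈ Y s}
  have hΦ : ∀ s, CR (Φ s) := by
    intro s
    rw [← compl_compl (Φ s)]
    apply CR.compl
    apply CR_open
    intro E hE _
    have hE : ¬ ∀ x ∈ E, Encodable.encode s ≤ x → m ≤ x → ∃ F ∈ cube E (x+1) B, F ∈ Y s := hE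
    push Not at hE
    obtain ⟨x, hxE, h1, h2, h3⟩ := hE
    refine ⟨x+1, fun E' _ hE' hcon => ?_⟩
    obtain ⟨F, hF, hFY⟩ := hcon x ((hE' x (by omega)).2 hxE) h1 h2
    rw [cube_congr B hE'] at hF
    exact h3 F hF hFY
  have hYΦ : ∀ s, ∀ E ∈ cube a m B, E ∈ Y s → E ∈ Φ s := by
    intro s E hE hEY x hx _ hm
    exact ⟨E, self_mem hE (by omega), hEY⟩
  let N : List ℕ → Set (Set ℕ) := fun s => Φ s ∩ (P s ∩ ⋃ n, Φ (s ++ [n]))ᶜ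
  have hN : ∀ s, CR (N s) := fun s =>
    (hΦ s).inter ((hP s).inter (CR.iUnion _ fun n => hΦ _)).compl
  have hempty : CR ∅ := CR_open (fun E hE => absurd hE (notMem_empty E))
  let N' : ℕ → Set (Set ℕ) := fun k => match Encodable.decode (α := List ℕ) k with
    | none => ∅
    | some s => N s
  have hN'e : ∀ s, N' (Encodable.encode s) = N s := by
    intro s
    simp [N']
  have hN' : ∀ k, CR (N' k) := by
    intro k
    simp only [N']
    split
    · exact hempty
    · exact hN _
  obtain ⟨D, hDB, hD, hdecN⟩ := decide_all N' hN' B hB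
  have hcube : cube a m D ⊆ cube a m B := cube_mono fun x hx _ => hDB hx
  have hnull : ∀ E ∈ cube a m D, ∀ s, E ∉ N s := by
    intro E hE s hEN
    obtain ⟨x, hxE, hx⟩ := inf_ge hE.1 (max (Encodable.encode s) m)
    have h1 : Encodable.encode s ≤ x := (le_max_left _ _).trans hx
    have h2 : m ≤ x := (le_max_right _ _).trans hx
    have hxD := hE.2.2 x h2 hxE
    have h3 : cube E (x+1) D ⊆ N s := by
      rcases hdecN _ x hxD h1 E with h | h
      · rwa [hN'e] at h
      · refine absurd ?_ (h E (self_mem hE (by omega)))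
        rwa [hN'e]
    obtain ⟨F, hF, hFY⟩ := hEN.1 x hxE h1 h2
    rcases hdec _ x (hDB hxD) h1 E with h4 | h4
    · exact h4 F hF ((hZ s F).2 hFY)
    · obtain ⟨G, hG, hGZ⟩ := h4 D hDB hD
      have hGY := (hZ s G).1 hGZ
      obtain ⟨n, hn⟩ := hYs s G hGY
      have hGc : G ∈ cube a m B := cube_sub (hcube hE) hDB (by omega) hG
      exact (h3 hG).2 ⟨hYP s hGY, mem_iUnion.2 ⟨n, hYΦ _ G hGc hn⟩⟩
  refine ⟨D, hDB.trans hBA, hD, Φ [], hΦ _, ?_⟩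
  intro E hE
  constructor
  · intro h
    obtain ⟨σ, hσ⟩ := mem_iUnion.1 h
    exact hYΦ [] E (hcube hE) ⟨σ, by simp, fun n => mem_iInter.1 hσ n⟩
  · intro h
    have hstep : ∀ s, E ∈ Φ s → E ∈ P s ∧ ∃ n, E ∈ Φ (s ++ [n]) := by
      intro s hs
      by_contra hcon
      refine hnull E hE s ⟨hs, fun h => hcon ⟨h.1, mem_iUnion.1 h.2⟩⟩
    have hstep2 : ∀ s, ∃ n, E ∈ Φ s → E ∈ Φ (s ++ [n]) := by
      intro s
      by_cases hs : E ∈ Φ s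
      · obtain ⟨n, hn⟩ := (hstep s hs).2
        exact ⟨n, fun _ => hn⟩
      · exact ⟨0, fun h => absurd h hs⟩
    choose g hg using hstep2
    let t : ℕ → List ℕ := fun k => Nat.rec [] (fun _ s => s ++ [g s]) k
    have ts : ∀ k, t (k+1) = t k ++ [g (t k)] := fun k => rfl
    have ht : ∀ k, E ∈ Φ (t k) := by
      intro k
      induction k with
      | zero => exact h
      | succ k ih => rw [ts]; exact hg _ ih
    have hof : ∀ k, (List.ofFn fun i : Fin k => g (t i)) = t k := by
      intro k
      induction k with
      | zero => simp [t]
      | succ k ih =>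
        rw [List.ofFn_succ', ts]
        simp only [Fin.val_castSucc, Fin.val_last, List.concat_eq_append]
        rw [ih]
    refine mem_iUnion.2 ⟨fun k => g (t k), mem_iInter.2 fun n => ?_⟩
    rw [hof n]
    exact (hstep _ (ht n)).1

lemma CR_of_CMeas {X : Type*} (f : Set ℕ → X → Bool)
    (hf : ∀ x : X, ∃ n : ℕ, ∀ E E' : Set ℕ, (∀ y, y < n → (y ∈ E ↔ y ∈ E')) → f E x = f E' x)
    (S : Set (X → Bool)) (hS : CMeas S) : CR (f ⁻¹' S) := by
  induction hS with
  | isOpen s hs =>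
    apply CR_open
    intro E hE _
    obtain ⟨I, u, hu, hsub⟩ := isOpen_pi_iff.1 hs (f E) hE
    choose n hn using hf
    refine ⟨I.sup n, fun E' _ hE' => hsub ?_⟩
    intro i hi
    rw [hn i E' E fun y hy => hE' y (hy.trans_le (Finset.le_sup hi))]
    exact (hu i hi).2
  | compl s _ ih => exact ih.compl
  | iUnion g _ ih =>
    rw [preimage_iUnion]
    exact CR.iUnion _ ih
  | souslin P _ ih =>
    simp only [preimage_iUnion, preimage_iInter]
    exact CR.souslin (fun s => f ⁻¹' P s) ih

def pairs (E : Set ℕ) : Set (ℕ × ℕ) :=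
  {p | p.1 ∈ E ∧ p.2 ∈ E ∧ p.1 < p.2 ∧ (∀ z, p.1 < z → z < p.2 → z ∉ E) ∧
    Even (E ∩ Iio p.1).ncard}

lemma pairs_congr {E E' : Set ℕ} {p : ℕ × ℕ} 
    (h : ∀ y, y < p.1 + p.2 + 1 → (y ∈ E ↔ y ∈ E')) : p ∈ pairs E ↔ p ∈ pairs E' := by
  have h1 : E ∩ Iio p.1 = E' ∩ Iio p.1 := by
    ext y
    simp only [mem_inter_iff, mem_Iio]
    constructor
    · rintro ⟨a, b⟩; exact ⟨(h y (by omega)).1 a, b⟩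
    · rintro ⟨a, b⟩; exact ⟨(h y (by omega)).2 a, b⟩
  have h2 : (∀ z, p.1 < z → z < p.2 → z ∉ E) ↔ (∀ z, p.1 < z → z < p.2 → z ∉ E') := by
    constructor
    · intro H z a b c; exact H z a b ((h z (by omega)).2 c)
    · intro H z a b c; exact H z a b ((h z (by omega)).1 c)
  simp only [pairs, mem_setOf_eq]
  rw [h1, h2, h p.1 (by omega), h p.2 (by omega)]

lemma thin (H : Set ℕ) (T : Set (ℕ × ℕ)) (hT : ∀ p ∈ T, p.1 ∈ H ∧ p.2 ∈ H ∧ p.1 < p.2)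
    (hinf : ∀ n, ∃ p ∈ T, n ≤ p.1) :
    ∃ E ⊆ H, E.Infinite ∧ pairs E ⊆ T ∧ (pairs E).Infinite := by
  choose f hfT hf using hinf
  let p : ℕ → ℕ × ℕ := fun k => Nat.rec (f 0) (fun _ q => f (q.2 + 1)) k
  have ps : ∀ k, p (k+1) = f ((p k).2 + 1) := fun k => rfl
  have hpT : ∀ k, p k ∈ T := by
    intro k
    cases k with
    | zero => exact hfT _
    | succ k => exact hfT _
  have hlt : ∀ k, (p k).2 < (p (k+1)).1 := fun k => by rw [ps]; exact hf _
  let h : ℕ → ℕ := fun i => if i % 2 = 0 then (p (i/2)).1 else (p (i/2)).2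
  have h0 : ∀ k, h (2*k) = (p k).1 := by intro k; simp [h]
  have h1 : ∀ k, h (2*k+1) = (p k).2 := by
    intro k
    have e1 : (2*k+1) % 2 = 1 := by omega
    have e2 : (2*k+1) / 2 = k := by omega
    simp [h, e1, e2]
  have hsm : StrictMono h := by
    apply strictMono_nat_of_lt_succ
    intro i
    obtain ⟨k, hk | hk⟩ := Nat.even_or_odd' i
    · rw [hk, h0, h1]; exact (hT _ (hpT k)).2.2
    · rw [hk, h1, show 2*k+1+1 = 2*(k+1) by ring, h0]; exact hlt k
  have hcard : ∀ i, (range h ∩ Iio (h i)).ncard = i := by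
    intro i
    have : range h ∩ Iio (h i) = h '' Iio i := by
      ext y
      constructor
      · rintro ⟨⟨j, rfl⟩, hj⟩
        exact ⟨j, hsm.lt_iff_lt.1 hj, rfl⟩
      · rintro ⟨j, hj, rfl⟩
        exact ⟨⟨j, rfl⟩, hsm hj⟩
    rw [this, ncard_image_of_injective _ hsm.injective]
    simp [ncard_eq_toFinset_card']
  refine ⟨range h, ?_, infinite_range_of_injective hsm.injective, ?_, ?_⟩
  · rintro _ ⟨i, rfl⟩
    obtain ⟨k, hk | hk⟩ := Nat.even_or_odd' i
    · rw [hk, h0]; exact (hT _ (hpT k)).1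
    · rw [hk, h1]; exact (hT _ (hpT k)).2.1
  · rintro ⟨u, v⟩ ⟨⟨i, hi⟩, ⟨j, hj⟩, huv, hz, hev⟩
    simp only at hi hj huv hz hev
    subst hi hj
    rw [hcard] at hev
    obtain ⟨k, hk⟩ := even_iff_two_dvd.1 hev
    have hij : i < j := hsm.lt_iff_lt.1 huv
    have : j = i + 1 := by
      by_contra hne
      exact hz (h (i+1)) (hsm (by omega)) (hsm (by omega)) ⟨_, rfl⟩
    rw [this, hk, h0, h1]
    exact hpT k
  · have : range p ⊆ pairs (range h) := by
      rintro _ ⟨k, rfl⟩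
      refine ⟨⟨2*k, h0 k⟩, ⟨2*k+1, h1 k⟩, (hT _ (hpT k)).2.2, ?_, ?_⟩
      · rintro _ a b ⟨j, rfl⟩
        rw [← h0] at a
        rw [← h1] at b
        have := hsm.lt_iff_lt.1 a
        have := hsm.lt_iff_lt.1 b
        omega
      · rw [← h0, hcard]; simp
    refine Infinite.mono this (infinite_range_of_injective ?_)
    intro k l hkl
    have : h (2*k) = h (2*l) := by rw [h0, h0, hkl]
    have := hsm.injective this
    omega

lemma exists_emb {X : Type*} [Countable X] (A : ℕ → Set X) (hA : ∀ n, (A n).Infinite) :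
    ∃ e : ℕ × ℕ → X, Function.Injective e ∧ ∀ p, e p ∈ A p.1 := by
  obtain ⟨c, hc⟩ := exists_injective_nat X
  have hex : ∀ k N : ℕ, ∃ x ∈ A (Nat.unpair k).1, N < c x := by
    intro k N
    have : (c '' A (Nat.unpair k).1).Infinite := (hA _).image hc.injOn
    obtain ⟨_, ⟨x, hx, rfl⟩, h⟩ := this.exists_gt N
    exact ⟨x, hx, h⟩
  choose f hf1 hf2 using hex
  let g : ℕ → X := fun k => Nat.rec (f 0 0) (fun k x => f (k+1) (c x)) k
  have gs : ∀ k, g (k+1) = f (k+1) (c (g k)) := fun k => rfl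
  have hg : ∀ k, g k ∈ A (Nat.unpair k).1 := by
    intro k
    cases k with
    | zero => exact hf1 _ _
    | succ k => exact hf1 _ _
  have hsm : StrictMono (c ∘ g) := strictMono_nat_of_lt_succ fun k => by
    simp only [Function.comp, gs]; exact hf2 _ _
  refine ⟨fun p => g (Nat.pair p.1 p.2), ?_, ?_⟩
  · rintro ⟨a, b⟩ ⟨a', b'⟩ h
    have := hsm.injective.of_comp h
    simpa [Nat.pair_eq_pair] using this
  · rintro ⟨a, b⟩
    simpa using hg (Nat.pair a b)

lemma chi_inj {X : Type*} : Function.Injective (chi : Set X → X → Bool) := by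
  intro A B h
  ext x
  have := congrFun h x
  simpa [chi] using this

end Ell

open Ell in
theorem stmt14 {X : Type*} [Countable X] [Infinite X]
    (𝒜 : Set (Set X)) (h𝒜P : 𝒜 ⊆ PInf X)
    (h𝒜M : MFamily 𝒜) (h𝒜C : CMeasFam 𝒜)
    (A : ℕ → Set X) (hA : ∀ n, A n ∈ perp (perp 𝒜)) :
    ∃ B ∈ perp (perp 𝒜), {n : ℕ | (B ∩ A n).Infinite}.Infinite := by
  obtain ⟨e, he, heA⟩ := exists_emb A fun n => (hA n).1
  have hCR := CR_of_CMeas (fun E => chi (e '' pairs E)) (by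
    intro x
    by_cases hx : ∃ p, e p = x
    · obtain ⟨p, rfl⟩ := hx
      refine ⟨p.1 + p.2 + 1, fun E E' h => ?_⟩
      have h2 : e p ∈ e '' pairs E ↔ e p ∈ e '' pairs E' := by
        rw [he.mem_set_image, he.mem_set_image, pairs_congr h]
      simp only [chi, decide_eq_decide]
      exact h2
    · refine ⟨0, fun E E' _ => ?_⟩
      have : ∀ E, x ∉ e '' pairs E := fun E ⟨p, _, h⟩ => hx ⟨p, h⟩
      simp only [chi, this]) _ h𝒜C
  obtain ⟨H, -, hH, hhom⟩ := hCR ∅ 0 univ infinite_univ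
  have hcube : ∀ E ⊆ H, E.Infinite → E ∈ cube ∅ 0 H := fun E hE hEi =>
    ⟨hEi, fun x hx => absurd hx (Nat.not_lt_zero x), fun x _ hx => hE hx⟩
  let W : Set (ℕ × ℕ) := {p | p.1 ∈ H ∧ p.2 ∈ H ∧ p.1 < p.2}
  have hcol : ∀ n ∈ H, (e '' {p | p ∈ W ∧ p.1 = n}).Infinite := by
    intro n hn
    refine Infinite.image he.injOn ?_
    refine ((inf_inter_Ici hH (n+1)).image (f := fun v => (n, v))
      (fun a _ b _ h => (Prod.mk.inj h).2)).mono ?_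
    rintro _ ⟨v, ⟨hv, hv'⟩, rfl⟩
    exact ⟨⟨hn, hv, hv'⟩, rfl⟩
  have hcolA : ∀ n, e '' {p | p ∈ W ∧ p.1 = n} ⊆ A n := by
    rintro n _ ⟨p, ⟨_, rfl⟩, rfl⟩
    exact heA p
  rcases hhom with hom | hom
  · have hom : ∀ E ⊆ H, E.Infinite → e '' pairs E ∈ 𝒜 := fun E hE hEi =>
      (chi_inj.mem_set_image).1 (hom (hcube E hE hEi))
    have hint : ∀ n ∈ H, (e '' W ∩ A n).Infinite := fun n hn =>
      (hcol n hn).mono (subset_inter (image_mono fun p hp => hp.1) (hcolA n))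
    refine ⟨e '' W, ⟨?_, ?_⟩, hH.mono hint⟩
    · obtain ⟨n, hn⟩ := hH.nonempty
      exact (hint n hn).mono inter_subset_left
    · intro Z hZ
      by_contra hinf
      let T : Set (ℕ × ℕ) := {p | p ∈ W ∧ e p ∈ Z}
      have hTi : T.Infinite := by
        intro hfin
        refine hinf ((hfin.image e).subset ?_)
        rintro _ ⟨⟨p, hp, rfl⟩, hpZ⟩
        exact ⟨p, ⟨hp, hpZ⟩, rfl⟩
      have hcolfin : ∀ n, {p | p ∈ T ∧ p.1 = n}.Finite := by
        intro n
        refine Finite.of_finite_image (((hA n).2 Z hZ).subset ?_) (f := e) he.injOn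
        rintro _ ⟨p, ⟨hp, rfl⟩, rfl⟩
        exact ⟨heA p, hp.2⟩
      have hbig : ∀ n, ∃ p ∈ T, n ≤ p.1 := by
        intro n
        by_contra hcon
        push Not at hcon
        refine hTi (((finite_Iio n).biUnion fun k _ => hcolfin k).subset ?_)
        intro p hp
        exact mem_biUnion (hcon p hp) ⟨hp, rfl⟩
      obtain ⟨E, hEH, hE, hET, -⟩ := thin H T (fun p hp => hp.1) hbig
      have hEA := hom E hEH hE
      refine h𝒜P hEA ((hZ.2 _ hEA).subset (subset_inter ?_ Subset.rfl))
      rintro _ ⟨p, hp, rfl⟩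
      exact (hET hp).2
  · exfalso
    have hom : ∀ E ⊆ H, E.Infinite → e '' pairs E ∉ 𝒜 := fun E hE hEi h =>
      hom E (hcube E hE hEi) (mem_image_of_mem _ h)
    have hS : ∀ i : ℕ, ∃ S ∈ 𝒜, ∃ n, i ≤ n ∧ S ⊆ e '' {p | p ∈ W ∧ p.1 = n} := by
      intro i
      obtain ⟨n, hn, hin⟩ := inf_ge hH i
      by_contra hcon
      have : e '' {p | p ∈ W ∧ p.1 = n} ∈ perp 𝒜 := by
        refine ⟨hcol n hn, fun S hS => ?_⟩
        by_contra hinf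
        exact hcon ⟨_, h𝒜M.1 S hS _ inter_subset_right hinf, n, hin, inter_subset_left⟩
      exact hcol n hn (((hA n).2 _ this).subset (subset_inter (hcolA n) Subset.rfl))
    choose S hS𝒜 n hn hSn using hS
    obtain ⟨B, hB, hBfin⟩ := h𝒜M.2 S hS𝒜
    have hBi : B.Infinite := h𝒜P hB
    obtain ⟨E, hEH, hE, hET, hpi⟩ := thin H {p | p ∈ W ∧ e p ∈ B} (fun p hp => hp.1) (by
      intro k
      obtain ⟨x, hx, hx'⟩ := (hBi.diff (hBfin k)).nonempty
      have hx'' : x ∈ ⋃ i : ℕ, ⋃ _ : k ≤ i, S i := by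
        by_contra h
        exact hx' ⟨hx, h⟩
      simp only [mem_iUnion] at hx''
      obtain ⟨i, hki, hxi⟩ := hx''
      obtain ⟨p, ⟨hpW, hp1⟩, rfl⟩ := hSn i hxi
      exact ⟨p, ⟨hpW, hx⟩, by rw [hp1]; exact hki.trans (hn i)⟩)
    refine hom E hEH hE (h𝒜M.1 B hB _ ?_ (hpi.image he.injOn))
    rintro _ ⟨p, hp, rfl⟩
    exact (hET hp).2
end

section
/- Let X be a countable infinite set and τ an analytic topology on X such that (X, τ) is Fréchet and has the weak diagonal sequence property. Let x ∈ X and 𝒞_x = {A ∈ 𝒫∞(X) : A converges to x}. Then for every sequence (A_n) in 𝒞_x there exists A ∈ 𝒞_x such that A ∩ A_n is infinite for infinitely many n ∈ ℕ. -/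
open Set

/-- A point `z` has the weak diagonal sequence property. -/
def WDSPpt {Z : Type*} [TopologicalSpace Z] (z : Z) : Prop :=
  ∀ y : ℕ → ℕ → Z, (∀ n, Filter.Tendsto (y n) Filter.atTop (nhds z)) →
    ∃ L : Set ℕ, L.Infinite ∧ ∃ k : ℕ → ℕ,
      ∀ U ∈ nhds z, {n ∈ L | y n (k n) ∉ U}.Finite

/-- A space has the weak diagonal sequence property if every point has it. -/
def WDSP (Z : Type*) [TopologicalSpace Z] : Prop := ∀ z : Z, WDSPpt z

/-- A topology on a countable set `X` is analytic if the collection of open sets,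
viewed as a subset of `2^X = X → Bool`, is an analytic set. -/
def AnalyticTopology (X : Type*) [TopologicalSpace X] : Prop :=
  AnalyticFam {s : Set X | IsOpen s}

/-- A space is Fréchet if every point of the closure of a set is the limit of a
sequence from the set. -/
def FrechetSp (Z : Type*) [TopologicalSpace Z] : Prop :=
  ∀ S : Set Z, ∀ z ∈ closure S, ∃ u : ℕ → Z, (∀ n, u n ∈ S) ∧
    Filter.Tendsto u Filter.atTop (nhds z)

/-- `𝒞_x`: the infinite subsets of `X` converging to `x`, i.e. every neighborhood of `x`
contains all but finitely many of their elements. -/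
def ConvFam {X : Type*} [TopologicalSpace X] (x : X) : Set (Set X) :=
  {A | A.Infinite ∧ ∀ U ∈ nhds x, (A \ U).Finite}

open Filter

/-- the list of the first `n` values of `a` -/
def pre15 (a : ℕ → ℕ) (n : ℕ) : List ℕ := (List.range n).map a

theorem pre15_succ (a : ℕ → ℕ) (n : ℕ) : pre15 a (n+1) = pre15 a n ++ [a n] := by
  simp [pre15, List.range_succ]

theorem pre15_succ' (a : ℕ → ℕ) (n : ℕ) :
    pre15 a (n+1) = a 0 :: pre15 (fun i => a (i+1)) n := by
  simp [pre15, List.range_succ_eq_map, Function.comp_def]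

theorem fusion15 (E : List ℕ → Set ℕ)
    (hE : ∀ s, ∀ᶠ n in (hyperfilter ℕ : Filter ℕ), n ∈ E s) :
    ∃ m : ℕ → ℕ, StrictMono m ∧ ∀ g : ℕ → ℕ, StrictMono g → ∀ n,
      m (g n) ∈ E (pre15 (m ∘ g) n) := by
  have hnext : ∀ l : List ℕ, ∃ n, (∀ x ∈ l, x < n) ∧ ∀ s, s.Sublist l → n ∈ E s := by
    intro l
    have h1 : ∀ᶠ n in (hyperfilter ℕ : Filter ℕ), ∀ x ∈ l, x < n := by
      have : ∀ᶠ n : ℕ in atTop, ∀ x ∈ l, x < n := by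
        have := (eventually_all_finset (l := (atTop : Filter ℕ)) l.toFinset
          (p := fun x n => x < n)).2 (fun x _ => eventually_gt_atTop x)
        simpa using this
      exact Nat.hyperfilter_le_atTop this
    have h2 : ∀ᶠ n in (hyperfilter ℕ : Filter ℕ), ∀ s ∈ l.sublists.toFinset, n ∈ E s :=
      (eventually_all_finset _).2 (fun s _ => hE s)
    obtain ⟨n, hn1, hn2⟩ := (h1.and h2).exists
    exact ⟨n, hn1, fun s hs => hn2 s (by simpa using hs)⟩
  choose next h1 h2 using hnext
  let L : ℕ → List ℕ := fun j => Nat.rec [] (fun _ l => l ++ [next l]) j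
  have hL : ∀ j, L (j+1) = L j ++ [next (L j)] := fun j => rfl
  have hsub : ∀ i j, i ≤ j → (L i).Sublist (L j) := by
    intro i j hij
    induction hij with
    | refl => exact List.Sublist.refl _
    | step _ ih => exact ih.trans (by rw [hL]; exact List.sublist_append_left _ _)
  refine ⟨fun j => next (L j), strictMono_nat_of_lt_succ fun j => ?_, ?_⟩
  · apply h1; rw [hL]; simp
  · intro g hg n
    apply h2
    induction n with
    | zero => simp [pre15]
    | succ n ih =>
      rw [pre15_succ]
      refine List.Sublist.trans ?_ (hsub (g n + 1) (g (n+1)) (hg (Nat.lt_succ_self n)))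
      rw [hL]
      exact List.Sublist.append ih (List.Sublist.refl _)

inductive Acc15 (Bad : List ℕ → Prop) : List ℕ → Prop
  | base (s : List ℕ) : Bad s → Acc15 Bad s
  | step (s : List ℕ) (D : Set ℕ) : (∀ᶠ n in (hyperfilter ℕ : Filter ℕ), n ∈ D) →
      (∀ n ∈ D, Acc15 Bad (s ++ [n])) → Acc15 Bad s

theorem acc15_strat (Bad : List ℕ → Prop) (s : List ℕ) (h : Acc15 Bad s) :
    ∃ E : List ℕ → Set ℕ, (∀ t, ∀ᶠ n in (hyperfilter ℕ : Filter ℕ), n ∈ E t) ∧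
      ∀ a : ℕ → ℕ, (∀ n, a n ∈ E (pre15 a n)) → ∃ j, Bad (s ++ pre15 a j) := by
  induction h with
  | base s hs => exact ⟨fun _ => univ, by simp, fun a _ => ⟨0, by simpa [pre15] using hs⟩⟩
  | step s D hD _ ih =>
    classical
    choose! F hF1 hF2 using ih
    refine ⟨fun t => match t with
      | [] => D
      | n :: t => {k | n ∈ D → k ∈ F n t}, ?_, ?_⟩
    · intro t
      cases t with
      | nil => exact hD
      | cons n t =>
        by_cases hn : n ∈ D
        · simpa [hn] using hF1 n hn t
        · simp [hn]
    · intro a ha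
      have h0 : a 0 ∈ D := by simpa [pre15] using ha 0
      obtain ⟨j, hj⟩ := hF2 (a 0) h0 (fun i => a (i+1)) (by
        intro n
        have := ha (n+1)
        rw [pre15_succ'] at this
        exact this h0)
      refine ⟨j+1, ?_⟩
      rw [pre15_succ']
      simpa using hj

theorem galvin15 (Bad : List ℕ → Prop) :
    ∃ m : ℕ → ℕ, StrictMono m ∧
      ((∀ g : ℕ → ℕ, StrictMono g → ∃ j, Bad (pre15 (m ∘ g) j)) ∨
       (∀ g : ℕ → ℕ, StrictMono g → ∀ j, ¬ Bad (pre15 (m ∘ g) j))) := by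
  by_cases h : Acc15 Bad []
  · obtain ⟨E, hE, hE2⟩ := acc15_strat Bad [] h
    obtain ⟨m, hm, hm2⟩ := fusion15 E hE
    exact ⟨m, hm, Or.inl fun g hg => by simpa using hE2 (m ∘ g) (hm2 g hg)⟩
  · obtain ⟨m, hm, hm2⟩ := fusion15
      (fun s => {n | ¬ Acc15 Bad s → ¬ Acc15 Bad (s ++ [n])}) (by
        intro s
        by_cases hs : Acc15 Bad s
        · simp [hs]
        · have : ¬ ∀ᶠ n in (hyperfilter ℕ : Filter ℕ), Acc15 Bad (s ++ [n]) :=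
            fun h' => hs (Acc15.step s {n | Acc15 Bad (s ++ [n])} h' (fun n hn => hn))
          rw [← Ultrafilter.eventually_not] at this
          simpa [hs] using this)
    refine ⟨m, hm, Or.inr fun g hg j hb => ?_⟩
    have key : ∀ j, ¬ Acc15 Bad (pre15 (m ∘ g) j) := by
      intro j
      induction j with
      | zero => simpa [pre15] using h
      | succ j ih => rw [pre15_succ]; exact hm2 g hg j ih
    exact key j (Acc15.base _ hb)

theorem thin15 (R : ℕ → ℕ → Prop) (h : ∀ N, ∃ l k, N < l ∧ l < k ∧ R l k) (c : ℕ → ℕ) :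
    ∃ g : ℕ → ℕ, StrictMono g ∧ (∀ i, R (g (2*i)) (g (2*i+1))) ∧ ∀ i, c i ≤ g i := by
  choose l k h1 h2 h3 using h
  let N : ℕ → ℕ := fun i => Nat.rec (c 0 + c 1)
    (fun i r => k r + c (2*(i+1)) + c (2*(i+1)+1)) i
  have hN : ∀ i, N (i+1) = k (N i) + c (2*(i+1)) + c (2*(i+1)+1) := fun i => rfl
  have hc : ∀ i, c (2*i) ≤ N i ∧ c (2*i+1) ≤ N i := by
    intro i
    cases i with
    | zero => exact ⟨Nat.le_add_right _ _, Nat.le_add_left _ _⟩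
    | succ i => rw [hN]; constructor <;> omega
  let g : ℕ → ℕ := fun i => if i % 2 = 0 then l (N (i/2)) else k (N (i/2))
  have ge : ∀ i, g (2*i) = l (N i) := fun i => by simp [g]
  have go : ∀ i, g (2*i+1) = k (N i) := fun i => by
    have : (2*i+1)/2 = i := by omega
    simp [g, this, Nat.add_mod]
  refine ⟨g, strictMono_nat_of_lt_succ fun i => ?_, fun i => ?_, fun i => ?_⟩
  · rcases Nat.even_or_odd' i with ⟨j, rfl | rfl⟩
    · rw [ge, go]; exact h2 _
    · rw [go, show 2*j+1+1 = 2*(j+1) by ring, ge]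
      have := h1 (N (j+1)); have := hN j; omega
  · rw [ge, go]; exact h3 _
  · rcases Nat.even_or_odd' i with ⟨j, rfl | rfl⟩
    · rw [ge]; have := hc j; have := h1 (N j); omega
    · rw [go]; have := hc j; have := h1 (N j); have := h2 (N j); omega

theorem compact15 {X : Type*} (φ : (ℕ → ℕ) → X → Bool) (hφ : Continuous φ) (x : X)
    (p : ℕ → X) (a : ℕ → ℕ)
    (h : ∀ j, ∃ y : ℕ → ℕ, φ y x = true ∧ (∀ i < j, y i ≤ a i) ∧
      ∀ i, 2*i+1 < j → φ y (p i) = false) :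
    ∃ y, φ y x = true ∧ ∀ i, φ y (p i) = false := by
  choose y h1 h2 h3 using h
  let c : ℕ → ℕ := fun i => a i + ∑ j ∈ Finset.range (i+1), y j i
  have hc : ∀ j, y j ∈ Set.pi univ (fun i => Set.Iic (c i)) := by
    intro j i _
    show y j i ≤ a i + ∑ j ∈ Finset.range (i+1), y j i
    by_cases hij : i < j
    · exact (h2 j i hij).trans (Nat.le_add_right _ _)
    · have := Finset.single_le_sum (f := fun j => y j i) (s := Finset.range (i+1))
        (fun _ _ => Nat.zero_le _) (Finset.mem_range.2 (show j < i+1 by omega))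
      exact le_trans this (Nat.le_add_left _ _)
  have hK : IsCompact (Set.pi univ (fun i => Set.Iic (c i)) : Set (ℕ → ℕ)) :=
    isCompact_univ_pi fun i => (Set.finite_Iic _).isCompact
  obtain ⟨z, _, ψ, hψ, hz⟩ := hK.tendsto_subseq hc
  have hev : ∀ q : X, Tendsto (fun n => φ (y (ψ n)) q) atTop (nhds (φ z q)) := fun q =>
    (((continuous_apply q).comp hφ).tendsto z).comp hz
  refine ⟨z, ?_, fun i => ?_⟩
  · exact tendsto_nhds_unique (hev x) (by simp [h1])
  · refine tendsto_nhds_unique (hev (p i)) (tendsto_const_nhds.congr' ?_)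
    filter_upwards [eventually_gt_atTop (2*i+1)] with n hn
    exact (h3 _ i (lt_of_lt_of_le hn (hψ.id_le n))).symm

theorem stmt15 {X : Type*} [Countable X] [Infinite X] [TopologicalSpace X]
    (ht : AnalyticTopology X) (hF : FrechetSp X) (hw : WDSP X)
    (x : X) (A : ℕ → Set X) (hA : ∀ n, A n ∈ ConvFam x) :
    ∃ B ∈ ConvFam x, {n : ℕ | (B ∩ A n).Infinite}.Infinite := by
  have hchi : ∀ (U : Set X) (q : X), chi U q = true ↔ q ∈ U := by intro U q; simp [chi]
  have hchi' : ∀ (U : Set X) (q : X), chi U q = false ↔ q ∉ U := by intro U q; simp [chi]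
  obtain ⟨φ, hφ, hr⟩ : ∃ φ : (ℕ → ℕ) → X → Bool, Continuous φ ∧
      range φ = chi '' {s : Set X | IsOpen s} := by
    have h := ht
    unfold AnalyticTopology AnalyticFam at h
    rw [MeasureTheory.AnalyticSet] at h
    rcases h with h | h
    · have : chi (univ : Set X) ∈ (∅ : Set (X → Bool)) := h ▸ ⟨univ, isOpen_univ, rfl⟩
      exact this.elim
    · exact h
  let e : ∀ n, ℕ ↪ A n := fun n => (hA n).1.natEmbedding
  have einj : ∀ n, Function.Injective (fun k => (e n k : X)) := fun n =>
    Subtype.val_injective.comp (e n).injective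
  have hcol : ∀ n, ∀ U ∈ nhds x, {k | (e n k : X) ∉ U}.Finite := by
    intro n U hU
    refine (((hA n).2 U hU).preimage (einj n).injOn).subset ?_
    intro k hk
    exact ⟨(e n k).2, hk⟩
  let Bad : List ℕ → Prop := fun s => ¬ ∃ y : ℕ → ℕ, φ y x = true ∧
    (∀ i < s.length, y i ≤ s.getD i 0) ∧
    ∀ i, 2*i+1 < s.length → φ y (e (s.getD (2*i) 0) (s.getD (2*i+1) 0)) = false
  have hBad : ∀ a j, ¬ Bad (pre15 a j) ↔ ∃ y : ℕ → ℕ, φ y x = true ∧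
      (∀ i < j, y i ≤ a i) ∧
      ∀ i, 2*i+1 < j → φ y (e (a (2*i)) (a (2*i+1))) = false := by
    intro a j
    have hl : (pre15 a j).length = j := by simp [pre15]
    have hg : ∀ i < j, (pre15 a j).getD i 0 = a i := by
      intro i hi; simp [pre15, hi]
    simp only [Bad, not_not, hl]
    refine exists_congr fun y => and_congr_right fun _ => and_congr ?_ ?_
    · exact forall_congr' fun i => forall_congr' fun hi => by rw [hg i hi]
    · exact forall_congr' fun i => forall_congr' fun hi => by
        rw [hg _ hi, hg (2*i) (by omega)]
  obtain ⟨m, hm, hB | hGd⟩ := galvin15 Bad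
  · have hsub : ∀ n, (⋃ l, (fun k => (e (m l) (m k) : X)) '' Ioi l) ∩ A (m n) ⊇
        (fun k => (e (m n) (m k) : X)) '' Ioi n := by
      rintro n _ ⟨k, hk, rfl⟩
      exact ⟨mem_iUnion.2 ⟨n, k, hk, rfl⟩, (e (m n) (m k)).2⟩
    have hinf : ∀ n, ((⋃ l, (fun k => (e (m l) (m k) : X)) '' Ioi l) ∩ A (m n)).Infinite :=
      fun n => ((Set.Ioi_infinite n).image
        (((einj (m n)).comp hm.injective).injOn)).mono (hsub n)
    refine ⟨⋃ l, (fun k => (e (m l) (m k) : X)) '' Ioi l,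
      ⟨(hinf 0).mono inter_subset_left, ?_⟩, ?_⟩
    · intro U hU
      by_contra hi
      obtain ⟨V, hVU, hVo, hxV⟩ := mem_nhds_iff.1 hU
      have hVm : V ∈ nhds x := hVo.mem_nhds hxV
      obtain ⟨y, hy⟩ : chi V ∈ range φ := hr ▸ ⟨V, hVo, rfl⟩
      obtain ⟨g, hg, hR, hc⟩ := thin15 (fun l k => (e (m l) (m k) : X) ∉ V) (by
        intro N
        by_contra! hcon
        apply hi
        refine Set.Finite.subset (Set.Finite.biUnion (Set.finite_Iic N) (t := fun l =>
          (fun k => (e (m l) k : X)) '' {k | (e (m l) k : X) ∉ V})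
          (fun l _ => (hcol (m l) V hVm).image _)) ?_
        rintro q ⟨hq, hqU⟩
        obtain ⟨l, k, hk, rfl⟩ := mem_iUnion.1 hq
        have hqV : (e (m l) (m k) : X) ∉ V := fun h => hqU (hVU h)
        have hl : l ≤ N := by
          by_contra hl
          exact hqV (hcon l k (not_le.1 hl) hk)
        exact mem_biUnion (show l ∈ Iic N from hl) ⟨m k, hqV, rfl⟩) y
      obtain ⟨j, hj⟩ := hB g hg
      refine (hBad _ _).2 ⟨y, ?_, ?_, ?_⟩ hj
      · rw [hy, hchi]; exact hxV
      · intro i _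
        exact (hc i).trans (hm.id_le _)
      · intro i _
        rw [hy, hchi']; exact hR i
    · refine (Set.infinite_range_of_injective hm.injective).mono ?_
      rintro _ ⟨n, rfl⟩
      exact hinf n
  · exfalso
    obtain ⟨L, hL, k, hk⟩ := hw x (fun n k => (e (m n) (m (n+1+k)) : X)) (by
      intro n U hU
      have h1 : Tendsto (fun k => m (n+1+k)) atTop cofinite := by
        rw [Nat.cofinite_eq_atTop]
        exact hm.tendsto_atTop.comp (tendsto_add_atTop_nat (n+1) |>.congr fun k => by ring)
      have h2 : ∀ᶠ k in cofinite, (e (m n) k : X) ∈ U := hcol (m n) U hU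
      exact h1.eventually h2)
    obtain ⟨g, hg, hR, -⟩ := thin15 (fun l q => l ∈ L ∧ q = l+1+k l) (by
      intro N
      obtain ⟨l, hl, hN⟩ := hL.exists_gt N
      exact ⟨l, _, hN, by omega, hl, rfl⟩) (fun _ => 0)
    obtain ⟨y, hyx, hy⟩ := compact15 φ hφ x
      (fun i => (e (m (g (2*i))) (m (g (2*i+1))) : X)) (m ∘ g)
      (fun j => (hBad _ _).1 (hGd g hg j))
    obtain ⟨U, hU, hUy⟩ : φ y ∈ chi '' {s : Set X | IsOpen s} := hr ▸ mem_range_self y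
    rw [← hUy, hchi] at hyx
    have hfin := hk U (IsOpen.mem_nhds hU hyx)
    refine (Set.infinite_range_of_injective (f := fun i => g (2*i)) ?_).mono ?_ hfin
    · intro i j hij
      have := hg.injective hij
      omega
    · rintro _ ⟨i, rfl⟩
      refine ⟨(hR i).1, ?_⟩
      have := hy i
      rw [← hUy, hchi', (hR i).2] at this
      exact this
end

section
/- Let ℋ ⊆ 𝒫∞(Σ) be a hereditary, C-measurable M-family such that for every t ∈ Σ the set {t ∪ {n} : n ∈ ℕ and t < {n}} belongs to ℋ. Define Δ : 𝐁 → 𝒫∞(Σ) by Δ((b_n)_n) = { (⋃_{i=0}^{3n} b_i) ∪ {min b_{3n+2}} : n ∈ ℕ }. Then there exists a block sequence 𝐛 ∈ 𝐁 such that Δ(𝐜) ∈ ℋ for every 𝐜 ∈ [𝐛]. -/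
open Set

/- Here the tree `Σ` of strictly increasing finite sequences of naturals is identified
with `Finset ℕ`; for `s t : Finset ℕ`, `s < t` means `max s < min t`. -/

/-- A block sequence: a sequence of nonempty finite subsets of `ℕ` with
`b n < b (n+1)` for all `n`. -/
def IsBlockSeq (b : ℕ → Finset ℕ) : Prop :=
  (∀ n, (b n).Nonempty) ∧ ∀ n : ℕ, ∀ x ∈ b n, ∀ y ∈ b (n + 1), x < y

/-- `⟨𝐛⟩`: all unions `⋃_{n ∈ F} b n` over finite nonempty `F ⊆ ℕ`. -/
def blockSpan (b : ℕ → Finset ℕ) : Set (Finset ℕ) :=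
  {s | ∃ F : Finset ℕ, F.Nonempty ∧ s = F.biUnion b}

/-- `𝐜 ∈ [𝐛]`: a block sequence all of whose terms belong to `⟨𝐛⟩`. -/
def memBracket (b c : ℕ → Finset ℕ) : Prop :=
  IsBlockSeq c ∧ ∀ n, c n ∈ blockSpan b

/-- The map `Δ : 𝐁 → 𝒫∞(Σ)`,
`Δ((b_n)_n) = { (⋃_{i=0}^{3n} b_i) ∪ {min b_{3n+2}} : n ∈ ℕ }`. -/
noncomputable def DeltaBlock (b : ℕ → Finset ℕ) (hb : ∀ n, (b n).Nonempty) :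
    Set (Finset ℕ) :=
  Set.range fun n : ℕ =>
    insert ((b (3 * n + 2)).min' (hb _)) ((Finset.range (3 * n + 1)).biUnion b)


namespace UR

open Filter

def pre {α : Type*} (x : ℕ → α) (k : ℕ) : List α := List.ofFn fun i : Fin k => x i

section basic
variable {α : Type*}

theorem pre_length (x : ℕ → α) (k : ℕ) : (pre x k).length = k := by simp [pre]

theorem pre_zero (x : ℕ → α) : pre x 0 = [] := by simp [pre]

theorem pre_succ (x : ℕ → α) (k : ℕ) : pre x (k + 1) = pre x k ++ [x k] := by
  rw [pre, List.ofFn_succ_last]; simp [pre]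

theorem pre_take (x : ℕ → α) {k m : ℕ} (h : k ≤ m) : (pre x m).take k = pre x k := by
  apply List.ext_getElem
  · simp [pre_length, h]
  · intro i h1 h2
    simp [pre]

def mem (s : List α) (F : List α → Set α) (x : ℕ → α) : Prop :=
  pre x s.length = s ∧ ∀ n, s.length ≤ n → x n ∈ F (pre x n)

theorem mem_mono {s : List α} {F G : List α → Set α} {x : ℕ → α} (h : mem s F x)
    (hFG : ∀ t, F t ⊆ G t) : mem s G x := ⟨h.1, fun n hn => hFG _ (h.2 n hn)⟩

theorem mem_pre {s : List α} {F : List α → Set α} {x : ℕ → α} (h : mem s F x) {k : ℕ}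
    (hk : s.length ≤ k) : mem (pre x k) F x :=
  ⟨by rw [pre_length], fun n hn => h.2 n (hk.trans (by rwa [pre_length] at hn))⟩

def force (U : Ultrafilter α) (s : List α) (X : Set (ℕ → α)) : Prop :=
  ∃ F : List α → Set α, (∀ t, F t ∈ U) ∧ ∀ x, mem s F x → x ∈ X

variable {U : Ultrafilter α}

theorem force_mono {s : List α} {X Y : Set (ℕ → α)} (h : force U s X) (hXY : X ⊆ Y) :
    force U s Y := by
  obtain ⟨F, hF, h⟩ := h
  exact ⟨F, hF, fun x hx => hXY (h x hx)⟩

theorem force_inter {s : List α} {X Y : Set (ℕ → α)} (h : force U s X) (h' : force U s Y) :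
    force U s (X ∩ Y) := by
  obtain ⟨F, hF, h⟩ := h
  obtain ⟨G, hG, h'⟩ := h'
  exact ⟨fun t => F t ∩ G t, fun t => inter_mem (hF t) (hG t), fun x hx =>
    ⟨h x (mem_mono hx fun _ => inter_subset_left), h' x (mem_mono hx fun _ => inter_subset_right)⟩⟩

/-- fusion -/
theorem fusion (U : Ultrafilter α) (X : ℕ → Set (ℕ → α)) :
    ∃ F : List α → Set α, (∀ t, F t ∈ U) ∧ ∀ s x, mem s F x → ∀ n k, n ≤ k → s.length ≤ k →
      force U (pre x k) (X n) → x ∈ X n := by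
  classical
  have key : ∀ n u, ∃ F : List α → Set α, (∀ t, F t ∈ U) ∧
      (force U u (X n) → ∀ x, mem u F x → x ∈ X n) := by
    intro n u
    by_cases h : force U u (X n)
    · obtain ⟨F, hF, h'⟩ := h
      exact ⟨F, hF, fun _ => h'⟩
    · exact ⟨fun _ => univ, fun _ => univ_mem, fun h' => absurd h' h⟩
  choose F hF hFX using key
  refine ⟨fun t => ⋂ p ∈ (Finset.range (t.length + 1) ×ˢ Finset.range (t.length + 1)),
    F p.1 (t.take p.2) t, fun t => ?_, ?_⟩
  · exact (biInter_finset_mem _).2 fun p _ => hF _ _ _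
  · intro s x hx n k hnk hsk hf
    apply hFX n _ hf
    refine ⟨by rw [pre_length], fun m hm => ?_⟩
    rw [pre_length] at hm
    have h1 := hx.2 m (hsk.trans hm)
    simp only [mem_iInter] at h1
    have h2 := h1 (n, k) (by simp [pre_length]; omega)
    simpa [pre_take x hm] using h2

theorem force_of_eventually {s : List α} {X : Set (ℕ → α)}
    (h : ∀ᶠ a in U, force U (s ++ [a]) X) : force U s X := by
  classical
  obtain ⟨F, hF, hFX⟩ := fusion U (fun _ => X)
  refine ⟨fun t => F t ∩ {a | t = s → force U (s ++ [a]) X}, fun t => inter_mem (hF t) ?_, ?_⟩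
  · filter_upwards [h] with a ha _ using ha
  · intro x hx
    have h1 := (hx.2 s.length le_rfl).2 hx.1
    refine hFX s x (mem_mono hx fun _ => inter_subset_left) 0 (s.length + 1) (by omega)
      (by omega) ?_
    rw [pre_succ, hx.1]
    exact h1

theorem eventually_of_force {s : List α} {X : Set (ℕ → α)} (h : force U s X) :
    ∀ᶠ a in U, force U (s ++ [a]) X := by
  obtain ⟨F, hF, h⟩ := h
  filter_upwards [hF s] with a ha
  refine ⟨F, hF, fun x hx => h x ?_⟩
  obtain ⟨h1, h2⟩ := hx
  simp only [List.length_append, List.length_singleton, pre_succ] at h1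
  obtain ⟨h3, h4⟩ := List.append_inj' h1 rfl
  refine ⟨h3, fun n hn => ?_⟩
  rcases eq_or_lt_of_le hn with rfl | hn
  · rw [h3]
    simp at h4
    rwa [h4]
  · exact h2 n (by simp; omega)

theorem invariance (U : Ultrafilter α) (X : Set (ℕ → α)) :
    ∃ F : List α → Set α, (∀ t, F t ∈ U) ∧ ∀ s x, mem s F x → ∀ k, s.length ≤ k →
      (force U (pre x k) X ↔ force U s X) := by
  refine ⟨fun t => {a | force U (t ++ [a]) X ↔ force U t X}, fun t => ?_, ?_⟩
  · by_cases h : force U t X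
    · filter_upwards [eventually_of_force h] with a ha
      simp [h, ha]
    · have : ∀ᶠ a in U, ¬ force U (t ++ [a]) X := by
        rw [Ultrafilter.eventually_not]
        exact fun h' => h (force_of_eventually h')
      filter_upwards [this] with a ha
      simp [h, ha]
  · intro s x hx k hk
    induction k, hk using Nat.le_induction with
    | base => rw [hx.1]
    | succ k hk ih =>
      rw [pre_succ, ← ih]
      exact hx.2 k hk

def Ramsey (U : Ultrafilter α) (X : Set (ℕ → α)) : Prop := ∀ s, force U s X ∨ force U s Xᶜ

def Null (U : Ultrafilter α) (X : Set (ℕ → α)) : Prop := ∀ s, force U s Xᶜ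

theorem Null.mono {X Y : Set (ℕ → α)} (h : Null U Y) (hXY : X ⊆ Y) : Null U X :=
  fun s => force_mono (h s) (compl_subset_compl.2 hXY)

theorem null_iUnion_nat {X : ℕ → Set (ℕ → α)} (h : ∀ n, Null U (X n)) : Null U (⋃ n, X n) := by
  intro s
  obtain ⟨F, hF, hFX⟩ := fusion U (fun n => (X n)ᶜ)
  refine ⟨F, hF, fun x hx => ?_⟩
  rw [mem_compl_iff, mem_iUnion]
  rintro ⟨n, hn⟩
  exact hFX s x hx n (max n s.length) (le_max_left _ _) (le_max_right _ _) (h n _) hn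

theorem null_iUnion {ι : Type*} [Countable ι] [Nonempty ι] {X : ι → Set (ℕ → α)}
    (h : ∀ n, Null U (X n)) : Null U (⋃ n, X n) := by
  obtain ⟨f, hf⟩ := exists_surjective_nat ι
  exact (null_iUnion_nat fun n => h (f n)).mono (hf.iUnion_comp X).ge

theorem ramsey_open (G : Set (List α)) : Ramsey U {x | ∃ k, pre x k ∈ G} := by
  intro s
  set O : Set (ℕ → α) := {x | ∃ k, pre x k ∈ G} with hO
  by_cases h : force U s O
  · exact Or.inl h
  right
  obtain ⟨F, hF, hFX⟩ := invariance U O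
  refine ⟨F, hF, fun x hx => ?_⟩
  rintro ⟨k, hk⟩
  apply h
  rw [← hFX s x hx (max k s.length) (le_max_right _ _)]
  refine ⟨fun _ => univ, fun _ => univ_mem, fun y hy => ⟨k, ?_⟩⟩
  have h1 := hy.1
  rw [pre_length] at h1
  rw [← pre_take y (le_max_left k s.length), h1, pre_take x (le_max_left _ _)]
  exact hk

theorem Ramsey.compl {X : Set (ℕ → α)} (h : Ramsey U X) : Ramsey U Xᶜ := by
  intro s
  rw [compl_compl]
  exact (h s).symm

theorem Ramsey.iUnion {X : ℕ → Set (ℕ → α)} (h : ∀ n, Ramsey U (X n)) :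
    Ramsey U (⋃ n, X n) := by
  intro s
  obtain ⟨F, hF, hFX⟩ := fusion U (fun n => (X n)ᶜ)
  obtain ⟨F', hF', hFX'⟩ := fusion U (fun _ => ⋃ n, X n)
  rcases ramsey_open (U := U) {t | s.length ≤ t.length ∧ ∃ n, force U t (X n)} s with h1 | h1
  · left
    refine force_mono (force_inter h1 (Y := {x | mem s F' x}) ⟨F', hF', fun x hx => hx⟩) ?_
    rintro x ⟨⟨k, hk, n, hn⟩, hx⟩
    rw [pre_length] at hk
    exact hFX' s x hx 0 k (Nat.zero_le _) hk (force_mono hn (subset_iUnion X n))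
  · right
    refine force_mono (force_inter h1 (Y := {x | mem s F x}) ⟨F, hF, fun x hx => hx⟩) ?_
    rintro x ⟨h2, hx⟩
    rw [mem_compl_iff, mem_iUnion]
    rintro ⟨n, hn⟩
    refine hFX s x hx n (max n s.length) (le_max_left _ _) (le_max_right _ _) ?_ hn
    refine (h n _).resolve_left fun h3 => h2 ⟨max n s.length, ?_, n, h3⟩
    rw [pre_length]
    exact le_max_right _ _

@[reducible]
def Ram (U : Ultrafilter α) : MeasurableSpace (ℕ → α) where
  MeasurableSet' := Ramsey U
  measurableSet_empty := fun s => Or.inr ⟨fun _ => univ, fun _ => univ_mem, fun x _ => by simp⟩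
  measurableSet_compl := fun _ h => h.compl
  measurableSet_iUnion := fun _ h => Ramsey.iUnion h

def hull (U : Ultrafilter α) (X : Set (ℕ → α)) : Set (ℕ → α) :=
  {x | ∃ m, ∀ k, m ≤ k → ¬ force U (pre x k) Xᶜ}

theorem hull_null {X : Set (ℕ → α)} : Null U (X \ hull U X) := by
  intro s
  obtain ⟨F, hF, hFX⟩ := fusion U (fun _ => Xᶜ)
  refine ⟨F, hF, fun x hx => ?_⟩
  rintro ⟨h1, h2⟩
  simp only [hull, mem_ofPred_eq, not_exists, not_forall, not_not] at h2
  obtain ⟨k, hk, hf⟩ := h2 s.length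
  exact hFX s x hx 0 k (Nat.zero_le _) hk hf h1

theorem force_hull_compl {X : Set (ℕ → α)} {s : List α} (h : force U s Xᶜ) :
    force U s (hull U X)ᶜ := by
  obtain ⟨F, hF, hFX⟩ := invariance U Xᶜ
  refine ⟨F, hF, fun x hx => ?_⟩
  rintro ⟨m, hm⟩
  exact hm (max m s.length) (le_max_left _ _) ((hFX s x hx _ (le_max_right _ _)).2 h)

theorem ramsey_hull {X : Set (ℕ → α)} : Ramsey U (hull U X) := by
  intro s
  by_cases h : force U s Xᶜ
  · exact Or.inr (force_hull_compl h)
  left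
  obtain ⟨F, hF, hFX⟩ := invariance U Xᶜ
  exact ⟨F, hF, fun x hx => ⟨s.length, fun k hk h' => h ((hFX s x hx k hk).1 h')⟩⟩

theorem Ramsey.diff {X Y : Set (ℕ → α)} (h : Ramsey U X) (h' : Ramsey U Y) : Ramsey U (X \ Y) :=
  @MeasurableSet.diff _ (Ram U) _ _ h h'

theorem Ramsey.inter {X Y : Set (ℕ → α)} (h : Ramsey U X) (h' : Ramsey U Y) : Ramsey U (X ∩ Y) :=
  @MeasurableSet.inter _ (Ram U) _ _ h h'

theorem Ramsey.souslin {P : List ℕ → Set (ℕ → α)} (hP : ∀ s, Ramsey U (P s)) :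
    Ramsey U (⋃ σ : ℕ → ℕ, ⋂ n : ℕ, P (pre σ n)) := by
  set A : List ℕ → Set (ℕ → α) := fun u =>
    {x | ∃ σ : ℕ → ℕ, pre σ u.length = u ∧ ∀ n, x ∈ P (pre σ n)} with hA
  have hA0 : (⋃ σ : ℕ → ℕ, ⋂ n : ℕ, P (pre σ n)) = A [] := by
    ext x
    simp [hA, pre_zero]
  have hAP : ∀ u, A u ⊆ P u := by
    rintro u x ⟨σ, h1, h2⟩
    have := h2 u.length
    rwa [h1] at this
  have hAs : ∀ u x, x ∈ A u → ∃ k, x ∈ A (u ++ [k]) := by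
    rintro u x ⟨σ, h1, h2⟩
    refine ⟨σ u.length, σ, ?_, h2⟩
    simp [pre_succ, h1]
  set E : List ℕ → Set (ℕ → α) := fun u => hull U (A u) ∩ P u with hE
  set N : List ℕ → Set (ℕ → α) := fun u => E u \ ⋃ k, E (u ++ [k]) with hN
  have hER : ∀ u, Ramsey U (E u) := fun u => ramsey_hull.inter (hP u)
  have hNR : ∀ u, Ramsey U (N u) := fun u => (hER u).diff (Ramsey.iUnion fun k => hER _)
  have hNN : ∀ u, Null U (N u) := by
    intro u s
    rcases hNR u s with h | h
    · have hZ : Null U (⋃ k, A (u ++ [k]) \ hull U (A (u ++ [k]))) :=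
        null_iUnion_nat fun k => hull_null
      have h1 : force U s (A u)ᶜ := by
        refine force_mono (force_inter h (hZ s)) ?_
        rintro x ⟨⟨_, h2⟩, h3⟩ h4
        obtain ⟨k, hk⟩ := hAs u x h4
        apply h2
        refine mem_iUnion.2 ⟨k, ?_, hAP _ hk⟩
        by_contra h5
        exact h3 (mem_iUnion.2 ⟨k, hk, h5⟩)
      exact force_mono (force_hull_compl h1) (compl_subset_compl.2 fun x hx => hx.1.1)
    · exact h
  have hNU : Null U (⋃ u, N u) := null_iUnion hNN
  have hEA : E [] \ ⋃ u, N u ⊆ A [] := by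
    rintro x ⟨h1, h2⟩
    have h3 : ∀ u, x ∈ E u → ∃ k, x ∈ E (u ++ [k]) := by
      intro u hu
      by_contra h
      exact h2 (mem_iUnion.2 ⟨u, hu, by simpa using h⟩)
    choose! f hf using h3
    let g : ℕ → List ℕ := fun n => Nat.rec [] (fun _ u => u ++ [f u]) n
    have hg : ∀ n, x ∈ E (g n) := by
      intro n
      induction n with
      | zero => exact h1
      | succ n ih => exact hf _ ih
    have hgp : ∀ n, pre (fun n => f (g n)) n = g n := by
      intro n
      induction n with
      | zero => rw [pre_zero]; rfl
      | succ n ih => rw [pre_succ, ih]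
    refine ⟨fun n => f (g n), by simp [pre_zero], fun n => ?_⟩
    rw [hgp]
    exact (hg n).2
  rw [hA0]
  intro s
  rcases hER [] s with h | h
  · exact Or.inl (force_mono (force_inter h (hNU s)) hEA)
  · right
    refine force_mono (force_inter h (hull_null (X := A []) s)) ?_
    rintro x ⟨h1, h2⟩ h3
    refine h1 ⟨?_, hAP _ h3⟩
    by_contra h4
    exact h2 ⟨h3, h4⟩

theorem ramsey_preimage {β : Type*} [TopologicalSpace β] [MeasurableSpace β] [BorelSpace β]
    (g : (ℕ → α) → β) (hg : @Measurable _ _ (Ram U) _ g) {Z : Set β} (hZ : CMeas Z) :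
    Ramsey U (g ⁻¹' Z) := by
  induction hZ with
  | isOpen s hs => exact hg hs.measurableSet
  | compl s _ ih => exact ih.compl
  | iUnion f _ ih => rw [preimage_iUnion]; exact Ramsey.iUnion ih
  | souslin P _ ih =>
    have := Ramsey.souslin ih
    rw [preimage_iUnion]
    simp only [preimage_iInter]
    exact this

end basic

attribute [local instance] Ultrafilter.semigroup

theorem exists_idem : ∃ U : Ultrafilter (Finset ℕ),
    (∀ n : ℕ, ∀ᶠ b : Finset ℕ in (U : Filter (Finset ℕ)), b.Nonempty ∧ ∀ x ∈ b, n ≤ x) ∧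
    ∀ p : Finset ℕ → Prop, (∀ᶠ a in U, p a) ↔ ∀ᶠ a in U, ∀ᶠ b in U, p (a ∪ b) := by
  letI : Semigroup (Finset ℕ) :=
    { mul := fun a b => a ∪ b
      mul_assoc := fun a b c => Finset.union_assoc a b c }
  let S : ℕ → Set (Finset ℕ) := fun n => {b | b.Nonempty ∧ ∀ x ∈ b, n ≤ x}
  let K : Set (Ultrafilter (Finset ℕ)) := ⋂ n, {U | S n ∈ U}
  have hK : IsClosed K := isClosed_iInter fun n => ultrafilter_isClosed_basic (S n)
  obtain ⟨U, hU, hUU⟩ := exists_idempotent_in_compact_subsemigroup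
    (Ultrafilter.continuous_mul_left (M := Finset ℕ)) K
    (by
      refine ⟨(hyperfilter ℕ).map (fun n => {n}), ?_⟩
      refine mem_iInter.2 fun n => ?_
      change S n ∈ (hyperfilter ℕ).map (fun n => ({n} : Finset ℕ))
      rw [Ultrafilter.mem_map]
      have : ∀ᶠ m in (hyperfilter ℕ : Filter ℕ), n ≤ m :=
        (Nat.hyperfilter_le_atTop) (eventually_ge_atTop n)
      filter_upwards [this] with m hm
      refine ⟨Finset.singleton_nonempty m, ?_⟩
      simpa using hm)
    hK.isCompact
    (by
      intro V hV W hW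
      refine mem_iInter.2 fun n => ?_
      have h1 := mem_iInter.1 hV n
      have h2 := mem_iInter.1 hW n
      change ∀ᶠ m in ↑(V * W), m ∈ S n
      rw [Ultrafilter.eventually_mul]
      filter_upwards [h1] with a ha
      filter_upwards [h2] with b hb
      refine ⟨ha.1.mono Finset.subset_union_left, ?_⟩
      intro x hx
      rcases Finset.mem_union.1 hx with h | h
      · exact ha.2 x h
      · exact hb.2 x h)
  refine ⟨U, fun n => mem_iInter.1 hU n, fun p => ?_⟩
  have := Ultrafilter.eventually_mul U U p
  rw [hUU] at this
  exact this

theorem block_lt {b : ℕ → Finset ℕ} (hb : IsBlockSeq b) {i j : ℕ} (hij : i < j) :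
    ∀ x ∈ b i, ∀ y ∈ b j, x < y := by
  induction j, hij using Nat.le_induction with
  | base => exact hb.2 i
  | succ j hj ih =>
    intro x hx y hy
    obtain ⟨z, hz⟩ := hb.1 j
    exact (ih x hx z hz).trans (hb.2 j z hz y hy)

def star (U : Ultrafilter (Finset ℕ)) (S : Set (Finset ℕ)) : Set (Finset ℕ) :=
  {x | x ∈ S ∧ ∀ᶠ y in U, x ∪ y ∈ S}

theorem exists_block (U : Ultrafilter (Finset ℕ))
    (hU : ∀ n : ℕ, ∀ᶠ b : Finset ℕ in (U : Filter (Finset ℕ)), b.Nonempty ∧ ∀ x ∈ b, n ≤ x)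
    (hidem : ∀ p : Finset ℕ → Prop, (∀ᶠ a in U, p a) ↔ ∀ᶠ a in U, ∀ᶠ b in U, p (a ∪ b))
    (F : List (Finset ℕ) → Set (Finset ℕ)) (hF : ∀ t, F t ∈ U) :
    ∃ b, IsBlockSeq b ∧ ∀ c, memBracket b c → mem [] F c := by
  classical
  have star_mem : ∀ t, ∀ᶠ y in U, y ∈ star U (F t) := by
    intro t
    have h1 : ∀ᶠ y in U, y ∈ F t := hF t
    have h2 := (hidem (fun y => y ∈ F t)).1 h1
    filter_upwards [h1, h2] with y h3 h4 using ⟨h3, h4⟩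
  have star_step : ∀ t x, x ∈ star U (F t) → ∀ᶠ y in U, x ∪ y ∈ star U (F t) := by
    intro t x hx
    have h2 := (hidem (fun y => x ∪ y ∈ F t)).1 hx.2
    filter_upwards [hx.2, h2] with y h3 h4
    refine ⟨h3, ?_⟩
    simpa only [Finset.union_assoc] using h4
  let good : Finset (List (Finset ℕ) × Finset ℕ) → Prop := fun L =>
    ∀ p ∈ L, ∀ᶠ y in U, p.2 ∪ y ∈ star U (F p.1)
  let St := {L // good L} × ℕ
  have step : ∀ q : St, ∃ y : Finset ℕ, y.Nonempty ∧ (∀ x ∈ y, q.2 ≤ x) ∧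
      ∀ p ∈ q.1.1, p.2 ∪ y ∈ star U (F p.1) := by
    rintro ⟨⟨L, hL⟩, m⟩
    have h1 : ∀ᶠ y in U, ∀ p ∈ L, p.2 ∪ y ∈ star U (F p.1) :=
      (eventually_all_finset L).2 hL
    obtain ⟨y, hy, hy'⟩ := ((hU m).and h1).exists
    exact ⟨y, hy.1, hy.2, hy'⟩
  choose Y hY1 hY2 hY3 using step
  let nxt : St → St := fun q =>
    ⟨⟨q.1.1 ∪ q.1.1.image (fun p => (p.1, p.2 ∪ Y q)) ∪
        q.1.1.image (fun p => (p.1 ++ [p.2 ∪ Y q], ∅)), by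
      intro p hp
      rw [Finset.mem_union, Finset.mem_union, Finset.mem_image, Finset.mem_image] at hp
      rcases hp with (hp | ⟨r, hr, rfl⟩) | ⟨r, hr, rfl⟩
      · exact q.1.2 p hp
      · exact star_step _ _ (hY3 q r hr)
      · simpa only [Finset.empty_union] using star_mem _⟩, (Y q).sup id + 1⟩
  let st : ℕ → St := fun n => nxt^[n] (⟨⟨{([], ∅)}, by
      intro p hp
      rw [Finset.mem_singleton] at hp
      subst hp
      simpa only [Finset.empty_union] using star_mem _⟩, 0⟩)
  have st_succ : ∀ n, st (n + 1) = nxt (st n) := fun n => Function.iterate_succ_apply' _ _ _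
  let L : ℕ → Finset (List (Finset ℕ) × Finset ℕ) := fun n => (st n).1.1
  let b : ℕ → Finset ℕ := fun n => Y (st n)
  have hL : ∀ n, L (n + 1) = L n ∪ (L n).image (fun p => (p.1, p.2 ∪ b n)) ∪
      (L n).image (fun p => (p.1 ++ [p.2 ∪ b n], ∅)) := by
    intro n
    change (st (n + 1)).1.1 = _
    rw [st_succ]
  have hb : IsBlockSeq b := by
    refine ⟨fun n => hY1 _, fun n x hx y hy => ?_⟩
    have h1 := hY2 _ y hy
    rw [st_succ] at h1
    have h2 : x ≤ (b n).sup id := Finset.le_sup (f := id) hx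
    exact lt_of_le_of_lt h2 h1
  have hL1 : ∀ n p, p ∈ L n → p ∈ L (n + 1) := by
    intro n p hp
    rw [hL]
    simp [hp]
  have hL2 : ∀ n t x, (t, x) ∈ L n → (t, x ∪ b n) ∈ L (n + 1) := by
    intro n t x hp
    rw [hL]
    exact Finset.mem_union_left _ (Finset.mem_union_right _ (Finset.mem_image.2 ⟨_, hp, rfl⟩))
  have hL3 : ∀ n t x, (t, x) ∈ L n → (t ++ [x ∪ b n], ∅) ∈ L (n + 1) := by
    intro n t x hp
    rw [hL]
    exact Finset.mem_union_right _ (Finset.mem_image.2 ⟨_, hp, rfl⟩)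
  have hL4 : ∀ n t x, (t, x) ∈ L n → x ∪ b n ∈ F t := fun n t x hp => (hY3 (st n) _ hp).1
  have hL5 : ∀ m t, (t, ∅) ∈ L m → ∀ k, m ≤ k → ∀ G : Finset ℕ, (∀ i ∈ G, m ≤ i ∧ i < k) →
      (t, G.biUnion b) ∈ L k := by
    intro m t ht k hk
    induction k, hk using Nat.le_induction with
    | base =>
      intro G hG
      have : G = ∅ := Finset.eq_empty_of_forall_notMem fun i hi => by
        have := hG i hi
        omega
      subst this
      simpa using ht
    | succ k hk ih =>
      intro G hG
      have h1 := ih (G.erase k) (fun i hi => by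
        rw [Finset.mem_erase] at hi
        have := hG i hi.2
        omega)
      by_cases hkG : k ∈ G
      · have h2 := hL2 _ _ _ h1
        rw [Finset.union_comm, ← Finset.biUnion_insert, Finset.insert_erase hkG] at h2
        exact h2
      · rw [Finset.erase_eq_of_notMem hkG] at h1
        exact hL1 _ _ h1
  refine ⟨b, hb, fun c hc => ⟨by simp [pre_zero], ?_⟩⟩
  choose G hG1 hG2 using hc.2
  have main : ∀ n m, (pre c n, ∅) ∈ L m → (∀ i ∈ G n, m ≤ i) →
      c n ∈ F (pre c n) ∧ ∃ m', (pre c (n + 1), ∅) ∈ L m' ∧ ∀ i ∈ G (n + 1), m' ≤ i := by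
    intro n m hm hmG
    set j := (G n).max' (hG1 n) with hj
    have hjG : j ∈ G n := Finset.max'_mem _ _
    have h1 := hL5 m _ hm j (hmG j hjG) ((G n).erase j) (fun i hi => by
      rw [Finset.mem_erase] at hi
      have h3 := hmG i hi.2
      have h4 := Finset.le_max' _ i hi.2
      rw [← hj] at h4
      have := hi.1
      omega)
    have h2 : ((G n).erase j).biUnion b ∪ b j = c n := by
      rw [Finset.union_comm, ← Finset.biUnion_insert, Finset.insert_erase hjG, hG2 n]
    have h3 := hL4 _ _ _ h1
    have h4 := hL3 _ _ _ h1
    rw [h2] at h3 h4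
    refine ⟨h3, j + 1, ?_, ?_⟩
    · rw [pre_succ]
      exact h4
    · intro i hi
      by_contra hij
      obtain ⟨x, hx⟩ := hb.1 j
      obtain ⟨y, hy⟩ := hb.1 i
      have hxc : x ∈ c n := by
        rw [hG2 n]
        exact Finset.mem_biUnion.2 ⟨j, hjG, hx⟩
      have hyc : y ∈ c (n + 1) := by
        rw [hG2 (n + 1)]
        exact Finset.mem_biUnion.2 ⟨i, hi, hy⟩
      have hxy := hc.1.2 n x hxc y hyc
      rcases (by omega : i = j ∨ i < j) with h | h
      · subst h
        have hyc' : y ∈ c n := by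
          rw [hG2 n]
          exact Finset.mem_biUnion.2 ⟨_, hjG, hy⟩
        exact lt_irrefl _ (hc.1.2 n y hyc' y hyc)
      · exact absurd (block_lt hb h y hy x hx) (by omega)
  have all : ∀ n, ∃ m, (pre c n, ∅) ∈ L m ∧ ∀ i ∈ G n, m ≤ i := by
    intro n
    induction n with
    | zero =>
      refine ⟨0, ?_, fun i _ => Nat.zero_le i⟩
      rw [pre_zero]
      exact Finset.mem_singleton_self _
    | succ n ih =>
      obtain ⟨m, h1, h2⟩ := ih
      exact (main n m h1 h2).2
  intro n _
  obtain ⟨m, h1, h2⟩ := all n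
  exact (main n m h1 h2).1

theorem inj_of_top {f : ℕ → Finset ℕ} {g : ℕ → ℕ} (h1 : ∀ n, g n ∈ f n)
    (h2 : ∀ n m, n < m → ∀ x ∈ f n, x < g m) : Function.Injective f := by
  intro n m h
  rcases lt_trichotomy n m with h3 | h3 | h3
  · have := h2 n m h3 (g m) (h ▸ h1 m)
    omega
  · exact h3
  · have := h2 m n h3 (g n) (h ▸ h1 n)
    omega

theorem exists_good (ℋ : Set (Set (Finset ℕ))) (hP : ℋ ⊆ PInf (Finset ℕ))
    (hher : Hered ℋ) (hM : MFamily ℋ)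
    (hsucc : ∀ t : Finset ℕ,
      {s : Finset ℕ | ∃ n : ℕ, (∀ a ∈ t, a < n) ∧ s = insert n t} ∈ ℋ)
    (b : ℕ → Finset ℕ) (hb : IsBlockSeq b) :
    ∃ c, ∃ hc : memBracket b c, DeltaBlock c hc.1.1 ∈ ℋ := by
  classical
  let t : ℕ → Finset ℕ := fun i => (Finset.range (i + 1)).biUnion b
  let mn : ℕ → ℕ := fun k => (b k).min' (hb.1 k)
  have hmn : ∀ k, mn k ∈ b k := fun k => Finset.min'_mem _ _
  have ht : ∀ i k, i < k → ∀ x ∈ t i, x < mn k := by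
    intro i k hik x hx
    obtain ⟨j, hj, hx⟩ := Finset.mem_biUnion.1 hx
    rw [Finset.mem_range] at hj
    exact block_lt hb (by omega : j < k) x hx _ (hmn k)
  let A : ℕ → Set (Finset ℕ) := fun i => range fun k => insert (mn (k + i + 2)) (t i)
  have hA : ∀ i, A i ∈ ℋ := by
    intro i
    refine hher _ (hsucc (t i)) _ ?_ ?_
    · rintro _ ⟨k, rfl⟩
      exact ⟨_, ht i _ (by omega), rfl⟩
    · refine infinite_range_of_injective (inj_of_top (g := fun k => mn (k + i + 2)) ?_ ?_)
      · intro n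
        exact Finset.mem_insert_self _ _
      · intro n m hnm x hx
        rcases Finset.mem_insert.1 hx with rfl | hx
        · exact block_lt hb (by omega) _ (hmn _) _ (hmn _)
        · exact ht i _ (by omega) x hx
  obtain ⟨B, hB, hBA⟩ := hM.2 A hA
  have hch : ∀ m, ∃ i k, m ≤ i ∧ i + 2 ≤ k ∧ insert (mn k) (t i) ∈ B := by
    intro m
    have h1 : (B : Set (Finset ℕ)).Infinite := hP hB
    obtain ⟨s, hs, hs'⟩ := (h1.sdiff (hBA m)).nonempty
    rw [Set.mem_sdiff, not_and, not_not] at hs'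
    have := hs' hs
    simp only [mem_iUnion] at this
    obtain ⟨i, hi, k, rfl⟩ := this
    exact ⟨i, k + i + 2, hi, by omega, hs⟩
  choose I K hI hK hIK using hch
  let q : ℕ → ℕ := fun n => Nat.rec 0 (fun _ m => K m + 1) n
  have hq : ∀ n, q (n + 1) = K (q n) + 1 := fun n => rfl
  let d : ℕ → ℕ := fun m => if m % 3 = 0 then q (m / 3) else
    if m % 3 = 1 then I (q (m / 3)) + 1 else K (q (m / 3))
  have d0 : ∀ n, d (3 * n) = q n := by
    intro n
    have h1 : (3 * n) % 3 = 0 := by omega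
    have h2 : (3 * n) / 3 = n := by omega
    simp only [d, h1, h2, if_true]
  have d1 : ∀ n, d (3 * n + 1) = I (q n) + 1 := by
    intro n
    have h1 : (3 * n + 1) % 3 = 1 := by omega
    have h2 : (3 * n + 1) / 3 = n := by omega
    simp [d, h1, h2]
  have d2 : ∀ n, d (3 * n + 2) = K (q n) := by
    intro n
    have h1 : (3 * n + 2) % 3 = 2 := by omega
    have h2 : (3 * n + 2) / 3 = n := by omega
    simp [d, h1, h2]
  have d3 : ∀ n, d (3 * n + 3) = K (q n) + 1 := fun n => by
    rw [← hq]
    exact d0 (n + 1)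
  have hd : ∀ m, d m < d (m + 1) := by
    intro m
    obtain ⟨n, h | h | h⟩ : ∃ n, m = 3 * n ∨ m = 3 * n + 1 ∨ m = 3 * n + 2 :=
      ⟨m / 3, by omega⟩
    · subst h
      rw [d0, d1]
      have := hI (q n)
      omega
    · subst h
      rw [d1, d2]
      have := hK (q n)
      omega
    · subst h
      rw [d2, d3]
      omega
  let c : ℕ → Finset ℕ := fun m => (Finset.Ico (d m) (d (m + 1))).biUnion b
  have hcb : IsBlockSeq c := by
    refine ⟨fun n => ?_, fun n x hx y hy => ?_⟩
    · obtain ⟨x, hx⟩ := hb.1 (d n)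
      exact ⟨x, Finset.mem_biUnion.2 ⟨d n, Finset.mem_Ico.2 ⟨le_rfl, hd n⟩, hx⟩⟩
    · obtain ⟨i, hi, hx⟩ := Finset.mem_biUnion.1 hx
      obtain ⟨j, hj, hy⟩ := Finset.mem_biUnion.1 hy
      rw [Finset.mem_Ico] at hi hj
      exact block_lt hb (by omega : i < j) x hx y hy
  have hc : memBracket b c :=
    ⟨hcb, fun n => ⟨_, Finset.nonempty_Ico.2 (hd n), rfl⟩⟩
  have hun : ∀ n, (Finset.range n).biUnion c = (Finset.range (d n)).biUnion b := by
    intro n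
    induction n with
    | zero =>
      have : d 0 = 0 := d0 0
      rw [this]
      rfl
    | succ n ih =>
      rw [Finset.range_add_one, Finset.biUnion_insert, ih]
      change (Finset.Ico (d n) (d (n + 1))).biUnion b ∪ _ = _
      rw [← Finset.union_biUnion]
      congr 1
      ext x
      have := hd n
      simp only [Finset.mem_union, Finset.mem_Ico, Finset.mem_range]
      omega
  have hc2 : ∀ n, c (3 * n + 2) = b (K (q n)) := by
    intro n
    change (Finset.Ico (d (3 * n + 2)) (d (3 * n + 3))).biUnion b = _
    rw [d2, d3]
    simp
  refine ⟨c, hc, hher B hB _ ?_ ?_⟩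
  · rintro _ ⟨n, rfl⟩
    have h1 := hIK (q n)
    have h2 : (c (3 * n + 2)).min' (hc.1.1 _) = mn (K (q n)) := by
      simp only [mn, hc2]
    simp only [h2, hun, d1]
    exact h1
  · refine infinite_range_of_injective
      (inj_of_top (g := fun n => (c (3 * n + 2)).min' (hc.1.1 _)) ?_ ?_)
    · intro n
      exact Finset.mem_insert_self _ _
    · intro n m hnm x hx
      rcases Finset.mem_insert.1 hx with rfl | hx
      · exact block_lt hcb (by omega) _ (Finset.min'_mem _ _) _ (Finset.min'_mem _ _)
      · obtain ⟨j, hj, hx⟩ := Finset.mem_biUnion.1 hx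
        rw [Finset.mem_range] at hj
        exact block_lt hcb (by omega : j < 3 * m + 2) _ hx _ (Finset.min'_mem _ _)

open Classical in
noncomputable def mn (s : Finset ℕ) : ℕ := if h : s.Nonempty then s.min' h else 0

noncomputable def Dl (x : ℕ → Finset ℕ) : Set (Finset ℕ) :=
  range fun n : ℕ => insert (mn (x (3 * n + 2))) ((Finset.range (3 * n + 1)).biUnion x)

theorem Dl_eq (x : ℕ → Finset ℕ) (hx : ∀ n, (x n).Nonempty) : Dl x = DeltaBlock x hx := by
  simp only [Dl, DeltaBlock, mn, hx, dif_pos]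

theorem pre_getD (x : ℕ → Finset ℕ) {j k : ℕ} (h : j < k) : (pre x k).getD j ∅ = x j := by
  simp [pre, List.getD_eq_getElem?_getD, h]

theorem measurable_Dl (U : Ultrafilter (Finset ℕ)) :
    @Measurable _ _ (Ram U) _ (fun x => chi (Dl x)) := by
  letI := Ram U
  rw [measurable_pi_iff]
  intro s
  refine measurable_to_bool ?_
  have h := ramsey_open (U := U) {t : List (Finset ℕ) | ∃ n, t.length = 3 * n + 3 ∧
    insert (mn (t.getD (3 * n + 2) ∅)) ((Finset.range (3 * n + 1)).biUnion
      fun j => t.getD j ∅) = s}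
  have key : ∀ x n, insert (mn ((pre x (3 * n + 3)).getD (3 * n + 2) ∅))
      ((Finset.range (3 * n + 1)).biUnion fun j => (pre x (3 * n + 3)).getD j ∅) =
      insert (mn (x (3 * n + 2))) ((Finset.range (3 * n + 1)).biUnion x) := by
    intro x n
    rw [pre_getD x (by omega)]
    congr 1
    refine Finset.biUnion_congr rfl fun j hj => ?_
    rw [Finset.mem_range] at hj
    exact pre_getD x (by omega)
  have e : (fun x => chi (Dl x) s) ⁻¹' {true} = {x | ∃ k, pre x k ∈
      {t : List (Finset ℕ) | ∃ n, t.length = 3 * n + 3 ∧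
    insert (mn (t.getD (3 * n + 2) ∅)) ((Finset.range (3 * n + 1)).biUnion
      fun j => t.getD j ∅) = s}} := by
    ext x
    rw [mem_preimage, mem_singleton_iff]
    simp only [chi, decide_eq_true_eq]
    constructor
    · rintro ⟨n, hn⟩
      refine ⟨3 * n + 3, n, pre_length _ _, ?_⟩
      rw [key]
      exact hn
    · rintro ⟨k, n, hk, hn⟩
      rw [pre_length] at hk
      subst hk
      rw [key] at hn
      exact ⟨n, hn⟩
  rw [e]
  exact h

theorem chi_inj {X : Type*} {A B : Set X} (h : chi A = chi B) : A = B := by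
  ext x
  have := congrFun h x
  simpa [chi] using this

end UR

theorem stmt17 (ℋ : Set (Set (Finset ℕ))) (hP : ℋ ⊆ PInf (Finset ℕ))
    (hher : Hered ℋ) (hM : MFamily ℋ) (hC : CMeasFam ℋ)
    (hsucc : ∀ t : Finset ℕ,
      {s : Finset ℕ | ∃ n : ℕ, (∀ a ∈ t, a < n) ∧ s = insert n t} ∈ ℋ) :
    ∃ b : ℕ → Finset ℕ, ∃ hb : IsBlockSeq b,
      ∀ c : ℕ → Finset ℕ, ∀ hc : memBracket b c, DeltaBlock c hc.1.1 ∈ ℋ := by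
  obtain ⟨U, hU, hidem⟩ := UR.exists_idem
  have hmem : ∀ c (hc : ∀ n, (c n).Nonempty),
      c ∈ (fun x => chi (UR.Dl x)) ⁻¹' (chi '' ℋ) ↔ DeltaBlock c hc ∈ ℋ := by
    intro c hc
    rw [mem_preimage, UR.Dl_eq c hc]
    constructor
    · rintro ⟨A, hA, h⟩
      rwa [← UR.chi_inj h]
    · intro h
      exact ⟨_, h, rfl⟩
  rcases UR.ramsey_preimage _ (UR.measurable_Dl U) hC [] with ⟨F, hF, h⟩ | ⟨F, hF, h⟩
  · obtain ⟨b, hb, hbc⟩ := UR.exists_block U hU hidem F hF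
    exact ⟨b, hb, fun c hc => (hmem c hc.1.1).1 (h c (hbc c hc))⟩
  · exfalso
    obtain ⟨b, hb, hbc⟩ := UR.exists_block U hU hidem F hF
    obtain ⟨c, hc, hcH⟩ := UR.exists_good ℋ hP hher hM hsucc b hb
    exact h c (hbc c hc) ((hmem c hc.1.1).2 hcH)
end

section
/- The family 𝒜 of all infinite subsets of ℕ^{<ℕ} that contain no infinite chain (that is, 𝒜 = ℐ_c^⊥, the orthogonal of the ideal generated by the infinite chains of ℕ^{<ℕ}) is an M-family. -/
open Set

/-- A set of finite sequences is a chain if its elements are pairwise comparable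
under end-extension (the prefix order). -/
def IsChainSet (C : Set (List ℕ)) : Prop :=
  ∀ s ∈ C, ∀ t ∈ C, s <+: t ∨ t <+: s

/-- Nodes comparable with a node of `F`. -/
def CmpSet (F : Set (List ℕ)) : Set (List ℕ) := {z | ∃ x ∈ F, x <+: z ∨ z <+: x}

theorem prefixes_finite (x : List ℕ) : {z : List ℕ | z <+: x}.Finite := by
  refine (x.inits.finite_toSet).subset ?_
  intro z hz
  simpa [List.mem_inits] using hz

theorem step19 (A : ℕ → Set (List ℕ))
    (hA : ∀ n, ¬ ∃ C ⊆ A n, C.Infinite ∧ IsChainSet C) (F : Set (List ℕ))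
    (hF : {n | (A n \ CmpSet F).Infinite}.Infinite) (N : ℕ) :
    ∃ x, (∃ n, N ≤ n ∧ x ∈ A n) ∧ x ∉ CmpSet F ∧
      {n | (A n \ CmpSet (insert x F)).Infinite}.Infinite := by
  obtain ⟨n, hn, hNn⟩ := hF.exists_gt N
  have h1 : ¬ IsChainSet (A n \ CmpSet F) := fun h => hA n ⟨_, diff_subset, hn, h⟩
  unfold IsChainSet at h1
  push Not at h1
  obtain ⟨x, hx, y, hy, hxy, hyx⟩ := h1
  have key : {n | (A n \ CmpSet F).Infinite} ⊆
      {n | (A n \ CmpSet (insert x F)).Infinite} ∪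
      {n | (A n \ CmpSet (insert y F)).Infinite} := by
    intro m hm
    by_contra hc
    simp only [mem_union, mem_setOf_eq, not_or, Set.not_infinite] at hc
    apply hm
    refine (((hc.1.union hc.2).union (prefixes_finite x)).union (prefixes_finite y)).subset ?_
    rintro z ⟨hz, hzF⟩
    by_contra hcon
    simp only [mem_union, mem_setOf_eq, not_or, mem_diff, not_and, not_not] at hcon
    obtain ⟨⟨⟨h1, h2⟩, h3⟩, h4⟩ := hcon
    obtain ⟨u, hu, hu'⟩ := h1 hz
    obtain ⟨v, hv, hv'⟩ := h2 hz
    rcases hu with rfl | hu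
    · rcases hv with rfl | hv
      · have a := hu'.resolve_right h3
        have b := hv'.resolve_right h4
        rcases List.prefix_or_prefix_of_prefix a b with h | h
        · exact hxy h
        · exact hyx h
      · exact hzF ⟨v, hv, hv'⟩
    · exact hzF ⟨u, hu, hu'⟩
  rcases infinite_union.1 (hF.mono key) with h | h
  · exact ⟨x, ⟨n, hNn.le, hx.1⟩, hx.2, h⟩
  · exact ⟨y, ⟨n, hNn.le, hy.1⟩, hy.2, h⟩

theorem stmt19 :
    MFamily {A : Set (List ℕ) | A.Infinite ∧
      ¬ ∃ C ⊆ A, C.Infinite ∧ IsChainSet C} := by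
  refine ⟨?_, ?_⟩
  · rintro A ⟨_, hA⟩ B hBA hB
    exact ⟨hB, fun ⟨C, hC, h⟩ => hA ⟨C, hC.trans hBA, h⟩⟩
  intro A hA
  choose f hf1 hf2 hf3 using step19 A (fun n => (hA n).2)
  have h0 : {n | (A n \ CmpSet ∅).Infinite}.Infinite := by
    have : {n | (A n \ CmpSet ∅).Infinite} = univ := by
      ext n
      simp [CmpSet, (hA n).1]
    rw [this]
    exact infinite_univ
  let G : ℕ → {F : Set (List ℕ) // {n | (A n \ CmpSet F).Infinite}.Infinite} :=
    fun k => Nat.rec ⟨∅, h0⟩ (fun k F => ⟨insert (f F.1 F.2 k) F.1, hf3 F.1 F.2 k⟩) k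
  let x : ℕ → List ℕ := fun k => f (G k).1 (G k).2 k
  have hG : ∀ k, (G (k+1)).1 = insert (x k) (G k).1 := fun k => rfl
  have hmem : ∀ j k, j < k → x j ∈ (G k).1 := by
    intro j k hjk
    induction k with
    | zero => omega
    | succ k ih =>
      rw [hG]
      rcases Nat.lt_succ_iff_lt_or_eq.1 hjk with h | h
      · exact Or.inr (ih h)
      · exact Or.inl (by rw [h])
  have hinc : ∀ j k, j < k → ¬ (x j <+: x k ∨ x k <+: x j) := fun j k hjk h =>
    hf2 (G k).1 (G k).2 k ⟨x j, hmem j k hjk, h⟩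
  have hinc' : ∀ j k, j ≠ k → ¬ (x j <+: x k ∨ x k <+: x j) := by
    intro j k hjk
    rcases lt_or_gt_of_ne hjk with h | h
    · exact hinc j k h
    · exact fun h' => hinc k j h h'.symm
  have hinj : Function.Injective x := by
    intro j k hjk
    by_contra h
    exact hinc' j k h (Or.inl (by rw [hjk]))
  refine ⟨range x, ⟨infinite_range_of_injective hinj, ?_⟩, ?_⟩
  · rintro ⟨C, hC, hCi, hch⟩
    obtain ⟨a, ha, b, hb, hab⟩ := hCi.nontrivial
    obtain ⟨j, rfl⟩ := hC ha
    obtain ⟨k, rfl⟩ := hC hb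
    exact hinc' j k (fun h => hab (by rw [h])) (hch _ ha _ hb)
  · intro n
    refine ((finite_Iio n).image x).subset ?_
    rintro _ ⟨⟨k, rfl⟩, hk⟩
    refine ⟨k, ?_, rfl⟩
    by_contra hkn
    obtain ⟨i, hi, hxi⟩ := hf1 (G k).1 (G k).2 k
    apply hk
    simp only [mem_Iio, not_lt] at hkn
    exact mem_iUnion.2 ⟨i, mem_iUnion.2 ⟨hkn.trans hi, hxi⟩⟩
end
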